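/- Let ω be divergence-free-velocity vorticity with u = K∗ω, ω ∈ L^∞(0,T; L^p(𝕋²)), p > 2, a weak Euler solution. Then for any even smooth mollifier φ, the identity ∫ d²ℓ ∇φ_ε(ℓ)·Δ_ℓu(x) |Δ_ℓω(x)|² = ∇·[u (ω²)_ε − (u ω²)_ε](x) + 4 Z̃_ε(ω)(x) holds, where Δ_ℓf(x) = f(x+ℓ) − f(x) and Z̃_ε(ω) := ½ω ∇·[(ωu)_ε] − ½ω (u·∇)ω_ε. Consequently the enstrophy defect Z(ω) admits the representation Z(ω) = lim_{ε→0} ¼∫ d²ℓ ∇φ_ε(ℓ)·Δ_ℓu |Δ_ℓω|² in the sense of distributions. -/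

import Mathlib

open MeasureTheory Filter Topology
open scoped ENNReal NNReal
noncomputable section

/-- The plane `ℝ²`; periodic functions on it model functions on the torus `𝕋²`. -/
abbrev V : Type := ℝ × ℝ

/-- A fundamental domain of the unit torus `𝕋² = ℝ²/ℤ²`. -/
def Fund : Set V := Set.Ico (0:ℝ) 1 ×ˢ Set.Ico (0:ℝ) 1

/-- The measure of the torus `𝕋²`, modeled as Lebesgue measure on a fundamental domain. -/
def μT : Measure V := volume.restrict Fund

/-- `f` is `ℤ²`-periodic, i.e. a function on the torus `𝕋²`. -/
def Periodic2 {E : Type*} (f : V → E) : Prop :=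
  ∀ x : V, f (x + (1, 0)) = f x ∧ f (x + (0, 1)) = f x

/-- A standard mollifier on `ℝ²`. -/
structure IsMollifier (φ : V → ℝ) : Prop where
  smooth : ContDiff ℝ (⊤ : ℕ∞) φ
  compactSupport : HasCompactSupport φ
  nonneg : ∀ x, 0 ≤ φ x
  unit_integral : ∫ x, φ x = 1

/-- Convolution `φ ⋆ f` on `ℝ²`. -/
def conv {E : Type*} [NormedAddCommGroup E] [NormedSpace ℝ E] (φ : V → ℝ) (f : V → E) :
    V → E :=
  MeasureTheory.convolution φ f (ContinuousLinearMap.lsmul ℝ ℝ) volume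

/-- The rescaled mollifier `φ_ε(x) = ε⁻² φ(x/ε)`. -/
def scaled (φ : V → ℝ) (ε : ℝ) : V → ℝ := fun x => ε⁻¹ ^ 2 * φ (ε⁻¹ • x)

/-- Mollification `f_ε = φ_ε ⋆ f`. -/
def mollify {E : Type*} [NormedAddCommGroup E] [NormedSpace ℝ E] (φ : V → ℝ) (ε : ℝ)
    (f : V → E) : V → E :=
  conv (scaled φ ε) f

/-- Divergence of a planar vector field. -/
def div2 (u : V → V) (x : V) : ℝ := (fderiv ℝ u x (1, 0)).1 + (fderiv ℝ u x (0, 1)).2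

/-- (Scalar) curl of a planar vector field. -/
def curl2 (u : V → V) (x : V) : ℝ := (fderiv ℝ u x (1, 0)).2 - (fderiv ℝ u x (0, 1)).1

/-- `u = K ∗ ω` on the torus, `K = ∇^⊥G` the Biot–Savart kernel: equivalently, `u` is the
unique periodic, mean-zero, divergence-free velocity field with vorticity `ω`. -/
structure BiotSavart (ω : V → ℝ) (u : V → V) : Prop where
  periodic : Periodic2 u
  differentiable : Differentiable ℝ u
  divfree : ∀ x, div2 u x = 0
  curl_eq : ∀ x, curl2 u x = ω x
  mean_zero : ∫ x in Fund, u x = 0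

/-- Smooth space-time test function on `(0,T) × 𝕋²`. -/
structure TestFn (T : ℝ) (ψ : ℝ → V → ℝ) : Prop where
  smooth : ContDiff ℝ (⊤ : ℕ∞) (fun q : ℝ × V => ψ q.1 q.2)
  periodic : ∀ t, Periodic2 (ψ t)
  support : ∃ a b : ℝ, 0 < a ∧ b < T ∧ ∀ t, t ∉ Set.Icc a b → ψ t = 0

/-- Euclidean dot product on `ℝ²`. -/
def dot (a b : V) : ℝ := a.1 * b.1 + a.2 * b.2

/-- Gradient of a scalar function on `ℝ²`. -/
def grad2 (f : V → ℝ) (x : V) : V := (fderiv ℝ f x (1, 0), fderiv ℝ f x (0, 1))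

/-- Laplacian of a scalar function on `ℝ²`. -/
def lap2 (f : V → ℝ) (x : V) : ℝ := div2 (grad2 f) x

/-- Weak solution of 2D incompressible Euler in vorticity-velocity form on `(0,T) × 𝕋²`. -/
def WeakEuler (T : ℝ) (ω : ℝ → V → ℝ) (u : ℝ → V → V) : Prop :=
  ∀ ψ : ℝ → V → ℝ, TestFn T ψ →
    ∫ t in Set.Ioo 0 T, ∫ x in Fund,
      ((deriv (fun s => ψ s x) t) * ω t x
        + dot (grad2 (ψ t) x) (u t x) * ω t x) = 0

/-- Space-time Lebesgue norm on `(0,T) × 𝕋²`. -/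
def stNorm {E : Type*} [NormedAddCommGroup E] (q : ℝ≥0∞) (T : ℝ) (f : ℝ → V → E) : ℝ≥0∞ :=
  eLpNorm (fun p : ℝ × V => f p.1 p.2) q ((volume.restrict (Set.Ioo 0 T)).prod μT)


/-- Smooth periodic spatial test function on `𝕋²`. -/
structure SpTest (χ : V → ℝ) : Prop where
  smooth : ContDiff ℝ (⊤ : ℕ∞) χ
  periodic : Periodic2 χ

section FundamentalDomain

variable {G : Type*} [NormedAddCommGroup G] [MeasurableSpace G] [BorelSpace G]
  {μ : Measure G} [μ.IsAddLeftInvariant] {Γ : AddSubgroup G} {D : Set G}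

open scoped Pointwise in
theorem isAddFundamentalDomain_image_add (hD : IsAddFundamentalDomain Γ D μ) (y : G) :
    IsAddFundamentalDomain Γ ((fun x => y + x) '' D) μ := hD.vadd_of_comm y

variable [Countable Γ]

theorem setIntegral_translate {E : Type*} [NormedAddCommGroup E] [NormedSpace ℝ E]
    (hD : IsAddFundamentalDomain Γ D μ) {f : G → E} (hf : ∀ (g : Γ) x, f (g +ᵥ x) = f x) (y : G) :
    ∫ x in D, f (x + y) ∂μ = ∫ x in D, f x ∂μ := by
  rw [hD.setIntegral_eq (isAddFundamentalDomain_image_add hD y) hf]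
  have h := (measurePreserving_add_left μ y).setIntegral_image_emb
    (MeasurableEquiv.addLeft y).measurableEmbedding f D
  rw [h]
  simp [add_comm]

theorem setLIntegral_translate
    (hD : IsAddFundamentalDomain Γ D μ) {f : G → ℝ≥0∞} (hf : ∀ (g : Γ) x, f (g +ᵥ x) = f x) (y : G) :
    ∫⁻ x in D, f (x + y) ∂μ = ∫⁻ x in D, f x ∂μ := by
  rw [hD.setLIntegral_eq (isAddFundamentalDomain_image_add hD y) f hf]
  have h := (measurePreserving_add_left μ y).setLIntegral_comp_emb
    (MeasurableEquiv.addLeft y).measurableEmbedding f D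
  rw [← h]
  simp [add_comm]

theorem integrableOn_translate {E : Type*} [NormedAddCommGroup E]
    (hD : IsAddFundamentalDomain Γ D μ) {f : G → E} (hf : ∀ (g : Γ) x, f (g +ᵥ x) = f x) (y : G)
    (hi : IntegrableOn f D μ) : IntegrableOn (fun x => f (x + y)) D μ := by
  rw [hD.integrableOn_iff (isAddFundamentalDomain_image_add hD y) hf] at hi
  have h := (measurePreserving_add_left μ y).integrableOn_image
    (MeasurableEquiv.addLeft y).measurableEmbedding (f := f) (s := D)
  rw [h] at hi
  simpa [Function.comp_def, add_comm] using hi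

variable [SecondCountableTopology G] [SFinite μ]

theorem integrable_kernel_prod {W : Type*} [MeasurableSpace W] {ν : Measure W} [SFinite ν]
    (hD : IsAddFundamentalDomain Γ D μ) {F : G → ℝ} (hF : ∀ (g : Γ) x, F (g +ᵥ x) = F x)
    (hFm : Measurable F) (hFi : IntegrableOn F D μ) {τ : W → G} (hτ : Measurable τ) {k : W → ℝ}
    (hk : Integrable k ν) :
    Integrable (fun p : G × W => k p.2 * F (p.1 - τ p.2)) ((μ.restrict D).prod ν) := by
  have hm : AEStronglyMeasurable (fun p : G × W => k p.2 * F (p.1 - τ p.2))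
      ((μ.restrict D).prod ν) := by
    refine AEStronglyMeasurable.mul hk.aestronglyMeasurable.comp_snd ?_
    exact (hFm.comp (measurable_fst.sub (hτ.comp measurable_snd))).aestronglyMeasurable
  rw [integrable_prod_iff' hm]
  constructor
  · refine Eventually.of_forall fun w => ?_
    refine Integrable.const_mul (f := fun z => F (z - τ w)) ?_ (k w)
    simpa [sub_eq_add_neg, IntegrableOn] using integrableOn_translate hD hF (-τ w) hFi
  · have : ∀ w, ∫ z in D, ‖k w * F (z - τ w)‖ ∂μ = ‖k w‖ * ∫ z in D, ‖F z‖ ∂μ := by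
      intro w
      simp_rw [norm_mul, integral_const_mul]
      congr 1
      simpa [sub_eq_add_neg] using
        setIntegral_translate hD (f := fun x => ‖F x‖) (by simp [hF]) (-τ w)
    simp_rw [this]
    exact hk.norm.mul_const _

theorem integrable_mul_kernel_prod {W : Type*} [MeasurableSpace W] {ν : Measure W} [SFinite ν]
    (hD : IsAddFundamentalDomain Γ D μ) {f g : G → ℝ} (hf : ∀ (c : Γ) x, f (c +ᵥ x) = f x)
    (hfm : Measurable f) (hgm : Measurable g)
    (hfi : IntegrableOn (fun x => f x ^ 2) D μ) (hgi : IntegrableOn (fun x => g x ^ 2) D μ)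
    {τ : W → G} (hτ : Measurable τ) {k : W → ℝ} (hk : Integrable k ν) :
    Integrable (fun p : G × W => g p.1 * (k p.2 * f (p.1 - τ p.2))) ((μ.restrict D).prod ν) := by
  have h1 := integrable_kernel_prod hD (F := fun x => f x ^ 2) (by simp [hf])
    (hfm.pow_const 2) hfi hτ hk
  have h2 : Integrable (fun p : G × W => g p.1 ^ 2 * k p.2) ((μ.restrict D).prod ν) :=
    Integrable.mul_prod hgi hk
  refine (h1.norm.add h2.norm).mono' ?_ (Eventually.of_forall fun p => ?_)
  · refine AEStronglyMeasurable.mul (hgm.comp measurable_fst).aestronglyMeasurable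
      (AEStronglyMeasurable.mul hk.aestronglyMeasurable.comp_snd ?_)
    exact (hfm.comp (measurable_fst.sub (hτ.comp measurable_snd))).aestronglyMeasurable
  · simp only [Pi.add_apply, norm_mul, norm_pow, Real.norm_eq_abs]
    have h0 := abs_nonneg (k p.2)
    nlinarith [mul_nonneg h0 (sq_nonneg (|g p.1| - |f (p.1 - τ p.2)|)),
      mul_nonneg h0 (sq_nonneg (|g p.1| )), mul_nonneg h0 (sq_nonneg (|f (p.1 - τ p.2)|))]

theorem integrable_mul_kernel
    (hD : IsAddFundamentalDomain Γ D μ) {k f g : G → ℝ} (hf : ∀ (c : Γ) x, f (c +ᵥ x) = f x)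
    (hfm : Measurable f) (hgm : Measurable g)
    (hfi : IntegrableOn (fun x => f x ^ 2) D μ) (hgi : IntegrableOn (fun x => g x ^ 2) D μ)
    (hk : Integrable k μ) :
    IntegrableOn (fun z => g z * ∫ w, k w * f (z - w) ∂μ) D μ := by
  simpa [IntegrableOn, integral_const_mul] using
    (integrable_mul_kernel_prod hD hf hfm hgm hfi hgi measurable_id hk).integral_prod_left

theorem setIntegral_mul_kernel_comm [μ.IsNegInvariant]
    (hD : IsAddFundamentalDomain Γ D μ) {k f g : G → ℝ} (hf : ∀ (c : Γ) x, f (c +ᵥ x) = f x)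
    (hg : ∀ (c : Γ) x, g (c +ᵥ x) = g x)
    (hfm : Measurable f) (hgm : Measurable g)
    (hfi : IntegrableOn (fun x => f x ^ 2) D μ) (hgi : IntegrableOn (fun x => g x ^ 2) D μ)
    (hk : Integrable k μ) :
    ∫ z in D, g z * ∫ w, k w * f (z - w) ∂μ ∂μ
      = ∫ z in D, f z * ∫ w, k (-w) * g (z - w) ∂μ ∂μ := by
  have h1 := integrable_mul_kernel_prod hD hf hfm hgm hfi hgi measurable_id hk
  have h2 := integrable_mul_kernel_prod hD hg hgm hfm hgi hfi measurable_id hk.comp_neg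
  simp_rw [← integral_const_mul]
  refine (integral_integral_swap h1).trans (Eq.trans ?_ (integral_integral_swap h2).symm)
  rw [← integral_neg_eq_self]
  congr 1 with w
  rw [← setIntegral_translate hD (f := fun z => g z * (k (-w) * f (z - -w))) ?_ (-w)]
  · congr 1 with z
    simp only [sub_eq_add_neg, neg_neg, neg_add_cancel_right]
    ring
  · intro c x
    simp only [sub_neg_eq_add]
    rw [hg, show (c +ᵥ x) + w = c +ᵥ (x + w) by simp [AddSubgroup.vadd_def, add_assoc], hf]

end FundamentalDomain

section Torus

/-- The lattice `ℤ²`. -/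
def lattice : AddSubgroup V :=
  (AddSubgroup.zmultiples (1 : ℝ)).prod (AddSubgroup.zmultiples (1 : ℝ))

/-- The lattice `0 × ℤ²` in space-time. -/
def stLattice : AddSubgroup (ℝ × V) := (⊥ : AddSubgroup ℝ).prod lattice

theorem mem_lattice {x : V} : x ∈ lattice ↔ ∃ m n : ℤ, x = ((m : ℝ), (n : ℝ)) := by
  simp only [lattice, AddSubgroup.mem_prod, AddSubgroup.mem_zmultiples_iff]
  constructor
  · rintro ⟨⟨m, hm⟩, n, hn⟩
    exact ⟨m, n, by ext <;> simp [← hm, ← hn]⟩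
  · rintro ⟨m, n, rfl⟩
    exact ⟨⟨m, by simp⟩, n, by simp⟩

instance : Countable lattice :=
  Function.Surjective.countable (f := fun p : ℤ × ℤ => (⟨((p.1 : ℝ), (p.2 : ℝ)),
    mem_lattice.2 ⟨p.1, p.2, rfl⟩⟩ : lattice)) (by
      rintro ⟨x, hx⟩
      obtain ⟨m, n, rfl⟩ := mem_lattice.1 hx
      exact ⟨(m, n), rfl⟩)

theorem mem_stLattice {x : ℝ × V} : x ∈ stLattice ↔ x.1 = 0 ∧ x.2 ∈ lattice := by
  simp [stLattice, AddSubgroup.mem_prod]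

instance : Countable stLattice :=
  Function.Surjective.countable (f := fun p : lattice => (⟨(0, (p : V)),
    mem_stLattice.2 ⟨rfl, p.2⟩⟩ : stLattice)) (by
      rintro ⟨⟨t, x⟩, hx⟩
      obtain ⟨h1, h2⟩ := mem_stLattice.1 hx
      refine ⟨⟨x, h2⟩, ?_⟩
      simp only [] at h1
      simp [h1])

theorem Periodic2.add_int {E : Type*} {f : V → E} (hf : Periodic2 f) (m n : ℤ) (x : V) :
    f (x + ((m : ℝ), (n : ℝ))) = f x := by
  have h1 : Function.Periodic f (1, 0) := fun x => (hf x).1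
  have h2 : Function.Periodic f (0, 1) := fun x => (hf x).2
  have h := (h1.zsmul m).add_period (h2.zsmul n)
  have e : m • ((1, 0) : V) + n • ((0, 1) : V) = ((m : ℝ), (n : ℝ)) := by ext <;> simp
  rw [e] at h
  exact h x

theorem Periodic2.vadd {E : Type*} {f : V → E} (hf : Periodic2 f) (g : lattice) (x : V) :
    f (g +ᵥ x) = f x := by
  obtain ⟨g, hg⟩ := g
  obtain ⟨m, n, rfl⟩ := mem_lattice.1 hg
  rw [AddSubgroup.vadd_def, vadd_eq_add, add_comm]
  exact hf.add_int m n x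

theorem vadd_of_periodic2 {E : Type*} {f : ℝ × V → E} (hf : ∀ t, Periodic2 fun x => f (t, x))
    (g : stLattice) (x : ℝ × V) : f (g +ᵥ x) = f x := by
  obtain ⟨⟨s, g⟩, hg⟩ := g
  obtain ⟨h1, h2⟩ := mem_stLattice.1 hg
  obtain ⟨t, x⟩ := x
  simp only at h1 h2
  subst h1
  have := (hf t).vadd ⟨g, h2⟩ x
  simpa [AddSubgroup.vadd_def] using this

theorem measurableSet_Fund : MeasurableSet Fund := measurableSet_Ico.prod measurableSet_Ico

theorem exists_unique_int_Fund (x : V) : ∃! p : ℤ × ℤ, ((p.1 : ℝ), (p.2 : ℝ)) + x ∈ Fund := by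
  refine ⟨(-⌊x.1⌋, -⌊x.2⌋), ?_, ?_⟩
  · simp only [Fund, Set.mem_prod, Set.mem_Ico, Prod.fst_add, Prod.snd_add]
    push_cast
    refine ⟨⟨?_, ?_⟩, ?_, ?_⟩ <;>
    linarith [Int.floor_le x.1, Int.floor_le x.2, Int.lt_floor_add_one x.1, Int.lt_floor_add_one x.2]
  · rintro ⟨m, n⟩ h
    simp only [Fund, Set.mem_prod, Set.mem_Ico, Prod.fst_add, Prod.snd_add] at h
    obtain ⟨⟨h1, h2⟩, h3, h4⟩ := h
    have e1 : ⌊x.1⌋ = -m := by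
      rw [Int.floor_eq_iff]; push_cast; constructor <;> linarith
    have e2 : ⌊x.2⌋ = -n := by
      rw [Int.floor_eq_iff]; push_cast; constructor <;> linarith
    simp [e1, e2]

theorem isAddFundamentalDomain_Fund : IsAddFundamentalDomain lattice Fund volume := by
  refine IsAddFundamentalDomain.mk' measurableSet_Fund.nullMeasurableSet fun x => ?_
  obtain ⟨p, hp, hu⟩ := exists_unique_int_Fund x
  refine ⟨⟨_, mem_lattice.2 ⟨p.1, p.2, rfl⟩⟩, hp, ?_⟩
  rintro ⟨g, hg⟩ h
  obtain ⟨m, n, rfl⟩ := mem_lattice.1 hg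
  rw [← hu (m, n) h]

theorem isAddFundamentalDomain_strip :
    IsAddFundamentalDomain stLattice ((Set.univ : Set ℝ) ×ˢ Fund) volume := by
  refine IsAddFundamentalDomain.mk'
    (MeasurableSet.univ.prod measurableSet_Fund).nullMeasurableSet fun x => ?_
  obtain ⟨p, hp, hu⟩ := exists_unique_int_Fund x.2
  refine ⟨⟨(0, ((p.1 : ℝ), (p.2 : ℝ))), mem_stLattice.2 ⟨rfl, mem_lattice.2 ⟨p.1, p.2, rfl⟩⟩⟩,
    Set.mk_mem_prod trivial hp, ?_⟩
  rintro ⟨⟨s, g⟩, hg⟩ h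
  obtain ⟨h1, h2⟩ := mem_stLattice.1 hg
  obtain ⟨m, n, e⟩ := mem_lattice.1 h2
  simp only at h1 e
  subst h1 e
  rw [← hu (m, n) h.2]

theorem volume_Fund : volume Fund = 1 := by
  rw [Fund, Measure.volume_eq_prod, Measure.prod_prod]
  simp

instance : IsProbabilityMeasure μT := ⟨by simp [μT, volume_Fund]⟩

theorem Periodic2.exists_mem_Fund {E : Type*} {f : V → E} (hf : Periodic2 f) (x : V) :
    ∃ y ∈ Fund, f x = f y := by
  obtain ⟨p, hp, -⟩ := exists_unique_int_Fund x
  exact ⟨_, hp, by rw [add_comm, hf.add_int]⟩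

theorem Fund_subset_Icc : Fund ⊆ Set.Icc (0 : V) 1 := by
  rintro x ⟨⟨h1, h2⟩, h3, h4⟩
  exact ⟨⟨h1, h3⟩, h2.le, h4.le⟩

theorem Periodic2.exists_bound {E : Type*} [NormedAddCommGroup E] {f : V → E}
    (hf : Periodic2 f) (hc : Continuous f) : ∃ C, ∀ x, ‖f x‖ ≤ C := by
  obtain ⟨C, hC⟩ := (isCompact_Icc (a := (0 : V)) (b := 1)).exists_bound_of_continuousOn hc.continuousOn
  refine ⟨C, fun x => ?_⟩
  obtain ⟨y, hy, h⟩ := hf.exists_mem_Fund x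
  rw [h]
  exact hC y (Fund_subset_Icc hy)

theorem Periodic2.comp_add {E : Type*} {f : V → E} (hf : Periodic2 f) (y : V) :
    Periodic2 fun x => f (x + y) := fun x => by
  beta_reduce
  constructor
  · rw [add_right_comm]; exact (hf _).1
  · rw [add_right_comm]; exact (hf _).2

theorem Periodic2.comp_left_add {E : Type*} {f : V → E} (hf : Periodic2 f) (y : V) :
    Periodic2 fun x => f (y + x) := by
  simpa only [add_comm] using hf.comp_add y

theorem Periodic2.map {E F : Type*} {f : V → E} (hf : Periodic2 f) (g : E → F) :
    Periodic2 fun x => g (f x) := fun x => ⟨congrArg g (hf x).1, congrArg g (hf x).2⟩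

theorem Periodic2.map₂ {E E' F : Type*} {f : V → E} {f' : V → E'} (hf : Periodic2 f)
    (hf' : Periodic2 f') (g : E → E' → F) :
    Periodic2 fun x => g (f x) (f' x) :=
  fun x => ⟨congrArg₂ g (hf x).1 (hf' x).1, congrArg₂ g (hf x).2 (hf' x).2⟩

/-- A bounded set meets finitely many lattice translates of the fundamental domain, uniformly in
the base point. -/
theorem exists_setLIntegral_le {K : Set V} (hK : Bornology.IsBounded K) :
    ∃ N : ℕ, ∀ F : V → ℝ≥0∞, Periodic2 F → ∀ x,
      ∫⁻ y in K, F (x + y) ≤ N * ∫⁻ y in Fund, F y := by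
  obtain ⟨R, hR⟩ := hK.subset_closedBall 0
  let n : ℤ := ⌈R⌉
  let S : Finset (ℤ × ℤ) := Finset.Icc (-n - 1) n ×ˢ Finset.Icc (-n - 1) n
  have hcov : K ⊆ ⋃ s ∈ S, (fun x : V => ((s.1 : ℝ), (s.2 : ℝ)) + x) '' Fund := by
    intro x hx
    have hxR : ‖x‖ ≤ R := by simpa using hR hx
    have h1 := (norm_fst_le x).trans hxR
    have h2 := (norm_snd_le x).trans hxR
    rw [Real.norm_eq_abs, abs_le] at h1 h2
    have hn : R ≤ n := Int.le_ceil R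
    obtain ⟨p, hp, -⟩ := exists_unique_int_Fund x
    simp only [Set.mem_iUnion]
    refine ⟨(-p.1, -p.2), ?_, _, hp, ?_⟩
    · simp only [Fund, Set.mem_prod, Set.mem_Ico, Prod.fst_add, Prod.snd_add] at hp
      obtain ⟨⟨a1, a2⟩, a3, a4⟩ := hp
      simp only [S, Finset.mem_product, Finset.mem_Icc]
      refine ⟨⟨?_, ?_⟩, ?_, ?_⟩
      · have : ((-n - 1 : ℤ) : ℝ) < ((-p.1 : ℤ) : ℝ) + 1 := by push_cast; linarith
        have : (-n - 1 : ℤ) < -p.1 + 1 := by exact_mod_cast this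
        omega
      · have : ((-p.1 : ℤ) : ℝ) ≤ (n : ℤ) := by push_cast; linarith
        exact_mod_cast this
      · have : ((-n - 1 : ℤ) : ℝ) < ((-p.2 : ℤ) : ℝ) + 1 := by push_cast; linarith
        have : (-n - 1 : ℤ) < -p.2 + 1 := by exact_mod_cast this
        omega
      · have : ((-p.2 : ℤ) : ℝ) ≤ (n : ℤ) := by push_cast; linarith
        exact_mod_cast this
    · ext <;> simp
  refine ⟨S.card, fun F hF x => ?_⟩
  calc ∫⁻ y in K, F (x + y)
      ≤ ∫⁻ y in ⋃ s ∈ S, (fun x : V => ((s.1 : ℝ), (s.2 : ℝ)) + x) '' Fund, F (x + y) :=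
        lintegral_mono_set hcov
    _ ≤ ∑ s ∈ S, ∫⁻ y in (fun x : V => ((s.1 : ℝ), (s.2 : ℝ)) + x) '' Fund, F (x + y) := by
        have h := lintegral_iUnion_le (μ := (volume : Measure V))
          (fun s : S => (fun x : V => ((s.1.1 : ℝ), (s.1.2 : ℝ)) + x) '' Fund) fun y => F (x + y)
        rw [tsum_fintype, Finset.sum_coe_sort S fun s =>
          ∫⁻ y in (fun x : V => ((s.1 : ℝ), (s.2 : ℝ)) + x) '' Fund, F (x + y)] at h
        refine le_trans (lintegral_mono_set ?_) h
        intro y hy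
        simp only [Set.mem_iUnion] at hy ⊢
        obtain ⟨s, hs, hy⟩ := hy
        exact ⟨⟨s, hs⟩, hy⟩
    _ = ∑ s ∈ S, ∫⁻ y in Fund, F y := by
        refine Finset.sum_congr rfl fun s _ => ?_
        rw [← isAddFundamentalDomain_Fund.setLIntegral_eq
          (isAddFundamentalDomain_image_add isAddFundamentalDomain_Fund _)
          (fun y => F (x + y)) (hF.comp_left_add x).vadd]
        simpa [add_comm] using setLIntegral_translate isAddFundamentalDomain_Fund hF.vadd x
    _ = S.card * ∫⁻ y in Fund, F y := by simp

end Torus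

section Divergence

theorem Icc_ae_eq_Fund : (Set.Icc (0 : V) 1 : Set V) =ᵐ[volume] Fund := by
  rw [show (0 : V) = (0, 0) from rfl, show (1 : V) = (1, 1) from rfl, ← Set.Icc_prod_Icc, Fund,
    Measure.volume_eq_prod]
  exact (Measure.set_prod_ae_eq Ico_ae_eq_Icc Ico_ae_eq_Icc).symm

theorem hasFDerivAt_fst_comp {F : V → V} (hF : Differentiable ℝ F) (x : V) :
    HasFDerivAt (fun y => (F y).1) ((ContinuousLinearMap.fst ℝ ℝ ℝ).comp (fderiv ℝ F x)) x :=
  (hF x).hasFDerivAt.fst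

theorem hasFDerivAt_snd_comp {F : V → V} (hF : Differentiable ℝ F) (x : V) :
    HasFDerivAt (fun y => (F y).2) ((ContinuousLinearMap.snd ℝ ℝ ℝ).comp (fderiv ℝ F x)) x :=
  (hF x).hasFDerivAt.snd

theorem setIntegral_div2_Icc {F : V → V} (hF : Differentiable ℝ F) {a b : V} (hab : a ≤ b)
    (hi : IntegrableOn (div2 F) (Set.Icc a b)) :
    ∫ x in Set.Icc a b, div2 F x =
      (((∫ x in a.1..b.1, (F (x, b.2)).2) - ∫ x in a.1..b.1, (F (x, a.2)).2) +
          ∫ y in a.2..b.2, (F (b.1, y)).1) - ∫ y in a.2..b.2, (F (a.1, y)).1 :=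
  integral_divergence_prod_Icc_of_hasFDerivAt_of_le (fun y => (F y).1) (fun y => (F y).2)
    (fun x => (ContinuousLinearMap.fst ℝ ℝ ℝ).comp (fderiv ℝ F x))
    (fun x => (ContinuousLinearMap.snd ℝ ℝ ℝ).comp (fderiv ℝ F x)) a b hab
    hF.continuous.fst.continuousOn hF.continuous.snd.continuousOn
    (fun x _ => hasFDerivAt_fst_comp hF x) (fun x _ => hasFDerivAt_snd_comp hF x) hi

theorem setIntegral_div2_Fund {F : V → V} (hF : Differentiable ℝ F) (hp : Periodic2 F)
    (hi : IntegrableOn (div2 F) Fund) : ∫ x in Fund, div2 F x = 0 := by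
  rw [← setIntegral_congr_set Icc_ae_eq_Fund,
    setIntegral_div2_Icc hF (by simp) (hi.congr_set_ae Icc_ae_eq_Fund)]
  have h1 : ∀ x : ℝ, F (x, 1) = F (x, 0) := fun x => by
    simpa using (hp (x, 0)).2
  have h2 : ∀ y : ℝ, F (1, y) = F (0, y) := fun y => by
    simpa using (hp (0, y)).1
  simp [h1, h2]

theorem integral_div2_eq_zero {F : V → V} (hF : Differentiable ℝ F) (hs : HasCompactSupport F)
    (hi : Integrable (div2 F)) : ∫ x, div2 F x = 0 := by
  obtain ⟨R, hR⟩ := hs.isCompact.isBounded.subset_ball 0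
  have hz : ∀ x : V, R ≤ ‖x‖ → F x = 0 := fun x hx => by
    by_contra h
    have := hR (subset_tsupport F h)
    simp at this
    linarith
  have hdz : ∀ x : V, R ≤ ‖x‖ → div2 F x = 0 := fun x hx => by
    have : x ∉ tsupport F := fun h => by
      have := hR h
      simp at this
      linarith
    have h0 := image_eq_zero_of_notMem_tsupport (fun h => this (tsupport_fderiv_subset ℝ h))
    simp [div2, h0]
  let S : ℝ := |R| + 1
  have hRS : R ≤ S := by have := le_abs_self R; simp only [S]; linarith
  have hS : 0 < S := by positivity
  have habs : R ≤ |S| := by rwa [abs_of_pos hS]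
  have hx1 : ∀ y : ℝ, F (S, y) = 0 := fun y => hz _ (habs.trans (norm_fst_le (S, y)))
  have hx2 : ∀ y : ℝ, F (-S, y) = 0 := fun y =>
    hz _ ((habs.trans_eq (abs_neg S).symm).trans (norm_fst_le (-S, y)))
  have hx3 : ∀ y : ℝ, F (y, S) = 0 := fun y => hz _ (habs.trans (norm_snd_le (y, S)))
  have hx4 : ∀ y : ℝ, F (y, -S) = 0 := fun y =>
    hz _ ((habs.trans_eq (abs_neg S).symm).trans (norm_snd_le (y, -S)))
  rw [← setIntegral_eq_integral_of_forall_compl_eq_zero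
    (s := Set.Icc ((-S, -S) : V) (S, S)), setIntegral_div2_Icc hF
      ⟨by simpa using by linarith, by simpa using by linarith⟩ hi.integrableOn]
  · simp [hx1, hx2, hx3, hx4]
  · intro x hx
    apply hdz
    by_contra! hlt
    have h1 := (norm_fst_le x).trans_lt hlt
    have h2 := (norm_snd_le x).trans_lt hlt
    rw [Real.norm_eq_abs, abs_lt] at h1 h2
    exact hx ⟨⟨by simpa using by linarith, by simpa using by linarith⟩,
      by simpa using by linarith, by simpa using by linarith⟩

theorem div2_smul {f : V → ℝ} {F : V → V} {x : V} (hf : DifferentiableAt ℝ f x)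
    (hF : DifferentiableAt ℝ F x) :
    div2 (fun y => f y • F y) x = dot (grad2 f x) (F x) + f x * div2 F x := by
  simp only [div2, dot, grad2]
  rw [fderiv_fun_smul hf hF]
  simp
  ring

theorem div2_sub {F H : V → V} {x : V} (hF : DifferentiableAt ℝ F x)
    (hH : DifferentiableAt ℝ H x) :
    div2 (fun y => F y - H y) x = div2 F x - div2 H x := by
  simp only [div2]
  rw [fderiv_fun_sub hF hH]
  simp
  ring

end Divergence

section LocalIntegrability

theorem Periodic2.integrableOn_of_isBounded {E : Type*} [NormedAddCommGroup E] {f : V → E}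
    (hf : Periodic2 f) (hm : AEStronglyMeasurable f) (hi : IntegrableOn f Fund) {K : Set V}
    (hK : Bornology.IsBounded K) : IntegrableOn f K := by
  obtain ⟨N, hN⟩ := exists_setLIntegral_le hK
  refine ⟨hm.restrict, ?_⟩
  have h := hN (fun x => ‖f x‖ₑ) (hf.map _) 0
  simp only [zero_add] at h
  exact h.trans_lt (ENNReal.mul_lt_top (by simp) hi.2)

theorem Periodic2.locallyIntegrable {E : Type*} [NormedAddCommGroup E] {f : V → E}
    (hf : Periodic2 f) (hm : AEStronglyMeasurable f) (hi : IntegrableOn f Fund) :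
    LocallyIntegrable f := by
  rw [locallyIntegrable_iff]
  exact fun K hK => hf.integrableOn_of_isBounded hm hi hK.isBounded

theorem locallyIntegrable_of_strip {E : Type*} [NormedAddCommGroup E] {f : ℝ × V → E}
    (hf : ∀ t, Periodic2 fun x => f (t, x)) (hm : StronglyMeasurable f)
    (hi : IntegrableOn f (Set.univ ×ˢ Fund)) :
    LocallyIntegrable f := by
  rw [locallyIntegrable_iff]
  intro K hK
  obtain ⟨N, hN⟩ := exists_setLIntegral_le (hK.image continuous_snd).isBounded
  have hsub : K ⊆ Set.univ ×ˢ (Prod.snd '' K) := fun x hx => ⟨trivial, x, hx, rfl⟩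
  refine IntegrableOn.mono_set ⟨hm.aestronglyMeasurable, ?_⟩ hsub
  have h2 := hi.2
  simp only [HasFiniteIntegral] at h2 ⊢
  rw [Measure.volume_eq_prod, ← Measure.prod_restrict, Measure.restrict_univ,
    lintegral_prod _ hm.enorm.aemeasurable] at h2 ⊢
  calc _ ≤ ∫⁻ t : ℝ, N * ∫⁻ x in Fund, ‖f (t, x)‖ₑ := lintegral_mono fun t => by
          simpa using hN (fun x => ‖f (t, x)‖ₑ) ((hf t).map _) 0
    _ = N * ∫⁻ t : ℝ, ∫⁻ x in Fund, ‖f (t, x)‖ₑ := by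
        rw [lintegral_const_mul _ hm.enorm.lintegral_prod_right']
    _ < ∞ := ENNReal.mul_lt_top (by simp) h2

end LocalIntegrability

section Kernel

theorem fderiv_convolution_apply {G E : Type*} [NormedAddCommGroup G] [NormedSpace ℝ G]
    [MeasurableSpace G] [BorelSpace G] [FiniteDimensional ℝ G]
    {μ : Measure G} [μ.IsAddHaarMeasure] [NormedAddCommGroup E] [NormedSpace ℝ E] [CompleteSpace E]
    {k : G → ℝ} (hk : ContDiff ℝ 1 k) (hs : HasCompactSupport k) {f : G → E}
    (hf : LocallyIntegrable f μ) (x v : G) :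
    fderiv ℝ (convolution k f (ContinuousLinearMap.lsmul ℝ ℝ) μ) x v
      = ∫ t, fderiv ℝ k t v • f (x - t) ∂μ := by
  have h := (hs.hasFDerivAt_convolution_left (ContinuousLinearMap.lsmul ℝ ℝ) hk hf x).fderiv
  rw [h, convolution_def, ContinuousLinearMap.integral_apply]
  · rfl
  · exact (hs.fderiv ℝ).convolutionExists_left _ (hk.continuous_fderiv one_ne_zero) hf x

theorem fderiv_neg_of_even {G : Type*} [NormedAddCommGroup G] [NormedSpace ℝ G] {k : G → ℝ}
    (hd : Differentiable ℝ k) (he : ∀ x, k (-x) = k x) (x v : G) :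
    fderiv ℝ k (-x) v = -fderiv ℝ k x v := by
  have h := (hd (-x)).hasFDerivAt.comp x (hasFDerivAt_id x).fun_neg
  have e : fderiv ℝ k x = _ := (h.congr_of_eventuallyEq
    (Eventually.of_forall fun y => (he y).symm)).fderiv
  simp [e]

/-- A smooth, even, compactly supported kernel. -/
structure IsKernel (k : V → ℝ) : Prop where
  smooth : ContDiff ℝ (⊤ : ℕ∞) k
  compactSupport : HasCompactSupport k
  even : ∀ x, k (-x) = k x

variable {k : V → ℝ}

theorem IsKernel.contDiff_one (hk : IsKernel k) : ContDiff ℝ 1 k :=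
  hk.smooth.of_le (by exact_mod_cast le_top)

theorem IsKernel.fderiv_neg (hk : IsKernel k) (x v : V) :
    fderiv ℝ k (-x) v = -fderiv ℝ k x v :=
  fderiv_neg_of_even (hk.contDiff_one.differentiable one_ne_zero) hk.even x v

theorem IsKernel.continuous_fderiv_apply (hk : IsKernel k) (v : V) :
    Continuous fun x => fderiv ℝ k x v :=
  (hk.contDiff_one.continuous_fderiv one_ne_zero).clm_apply continuous_const

theorem IsKernel.hasCompactSupport_fderiv_apply (hk : IsKernel k) (v : V) :
    HasCompactSupport fun x => fderiv ℝ k x v :=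
  hk.compactSupport.fderiv_apply (𝕜 := ℝ) v

theorem Periodic2.conv {E : Type*} [NormedAddCommGroup E] [NormedSpace ℝ E] {f : V → E}
    (hf : Periodic2 f) : Periodic2 (conv k f) := fun x => by
  simp only [_root_.conv, convolution_def, add_sub_right_comm, (hf _).1, (hf _).2, and_self]

theorem IsKernel.fderiv_conv {E : Type*} [NormedAddCommGroup E] [NormedSpace ℝ E]
    [CompleteSpace E] (hk : IsKernel k) {f : V → E} (hf : LocallyIntegrable f) (x v : V) :
    fderiv ℝ (conv k f) x v = -∫ l, fderiv ℝ k l v • f (x + l) := by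
  rw [_root_.conv, fderiv_convolution_apply hk.contDiff_one hk.compactSupport hf,
    ← integral_neg_eq_self, ← integral_neg]
  simp [hk.fderiv_neg]

theorem integrable_mul_of_periodic {a f : V → ℝ} (ha : Continuous a) (hs : HasCompactSupport a)
    (hf : Periodic2 f) (hm : Measurable f) (hi : IntegrableOn f Fund) (x : V) :
    Integrable fun l => a l * f (x + l) := by
  have h := (hf.comp_left_add x).locallyIntegrable
    (hm.comp (measurable_const_add x)).aestronglyMeasurable (by
      simpa [add_comm] using
        integrableOn_translate isAddFundamentalDomain_Fund hf.vadd x hi)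
  exact h.integrable_smul_left_of_hasCompactSupport ha hs

theorem dot_grad2_conv (hk : IsKernel k) {f : V → ℝ} (hf : Periodic2 f) (hm : Measurable f)
    (hi : IntegrableOn f Fund) (v x : V) :
    dot v (grad2 (conv k f) x) = -∫ l, dot (grad2 k l) v * f (x + l) := by
  have hl := hf.locallyIntegrable hm.aestronglyMeasurable hi
  simp only [dot, grad2, hk.fderiv_conv hl, smul_eq_mul, add_mul]
  have h := fun w => integrable_mul_of_periodic (hk.continuous_fderiv_apply w)
    (hk.hasCompactSupport_fderiv_apply w) hf hm hi x
  have e : ∀ w c, (fun l => fderiv ℝ k l w * c * f (x + l))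
    = fun l => c * (fderiv ℝ k l w * f (x + l)) := fun w c => by ext; ring
  rw [integral_add (by rw [e]; exact (h _).const_mul _) (by rw [e]; exact (h _).const_mul _),
    e, e, integral_const_mul, integral_const_mul]
  ring

theorem div2_conv (hk : IsKernel k) {F : V → V} (hF : Periodic2 F) (hm : Measurable F)
    (hi : IntegrableOn F Fund) (x : V) :
    div2 (conv k F) x = -∫ l, dot (grad2 k l) (F (x + l)) := by
  have hl := hF.locallyIntegrable hm.aestronglyMeasurable hi
  have h1 := fun w => integrable_mul_of_periodic (hk.continuous_fderiv_apply w)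
    (hk.hasCompactSupport_fderiv_apply w) (hF.map Prod.fst) hm.fst hi.fst x
  have h2 := fun w => integrable_mul_of_periodic (hk.continuous_fderiv_apply w)
    (hk.hasCompactSupport_fderiv_apply w) (hF.map Prod.snd) hm.snd hi.snd x
  have h3 : ∀ w, Integrable fun l => fderiv ℝ k l w • F (x + l) := fun w => (h1 w).prodMk (h2 w)
  simp only [div2, hk.fderiv_conv hl, dot, grad2]
  rw [integral_add (h1 _) (h2 _), Prod.fst_neg, Prod.snd_neg, fst_integral (h3 _),
    snd_integral (h3 _)]
  simp
  ring

theorem integrable_dot_grad2 (hk : IsKernel k) {F : V → V} (hF : Periodic2 F) (hm : Measurable F)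
    (hi : IntegrableOn F Fund) (x : V) :
    Integrable fun l => dot (grad2 k l) (F (x + l)) :=
  (integrable_mul_of_periodic (hk.continuous_fderiv_apply _)
    (hk.hasCompactSupport_fderiv_apply _) (hF.map Prod.fst) hm.fst hi.fst x).add
  (integrable_mul_of_periodic (hk.continuous_fderiv_apply _)
    (hk.hasCompactSupport_fderiv_apply _) (hF.map Prod.snd) hm.snd hi.snd x)

theorem integral_dot_grad2_eq_zero (hk : IsKernel k) {F : V → V} (hF : Differentiable ℝ F)
    (hd : ∀ x, div2 F x = 0) : ∫ l, dot (grad2 k l) (F l) = 0 := by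
  have hkd : Differentiable ℝ k := hk.contDiff_one.differentiable one_ne_zero
  have e : (div2 fun l => k l • F l) = fun l => dot (grad2 k l) (F l) := by
    ext l
    rw [div2_smul (hkd l) (hF l), hd, mul_zero, add_zero]
  rw [← e]
  refine integral_div2_eq_zero (hkd.smul hF) hk.compactSupport.smul_right ?_
  rw [e]
  refine Continuous.integrable_of_hasCompactSupport ?_ ?_
  · have h1 := hk.continuous_fderiv_apply (1, 0)
    have h2 := hk.continuous_fderiv_apply (0, 1)
    have := hF.continuous
    simp only [dot, grad2]
    fun_prop
  · exact ((hk.hasCompactSupport_fderiv_apply (1, 0)).mul_right).add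
      ((hk.hasCompactSupport_fderiv_apply (0, 1)).mul_right)

theorem div2_comp_add_sub {u : V → V} (x c l : V) :
    div2 (fun l => u (x + l) - c) l = div2 u (x + l) := by
  simp only [div2, fderiv_sub_const]
  rw [fderiv_comp_add_left]

theorem integral_linear_comb {α : Type*} [MeasurableSpace α] {μ : Measure α}
    {a b c d e : α → ℝ} (ha : Integrable a μ) (hb : Integrable b μ) (hc : Integrable c μ)
    (hd : Integrable d μ) (he : Integrable e μ) (r s : ℝ) :
    ∫ x, (a x - b x - r * c x + r * d x + s * e x) ∂μ
      = ∫ x, a x ∂μ - ∫ x, b x ∂μ - r * ∫ x, c x ∂μ + r * ∫ x, d x ∂μ + s * ∫ x, e x ∂μ := by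
  have h1 : Integrable (fun x => a x - b x) μ := ha.sub hb
  have h2 : Integrable (fun x => a x - b x - r * c x) μ := h1.sub (hc.const_mul r)
  have h3 : Integrable (fun x => a x - b x - r * c x + r * d x) μ := h2.add (hd.const_mul r)
  rw [integral_add h3 (he.const_mul s), integral_add h2 (hd.const_mul r),
    integral_sub h1 (hc.const_mul r), integral_sub ha hb, integral_const_mul, integral_const_mul,
    integral_const_mul]

/-- The pointwise algebraic identity behind the local `−2` law. -/
theorem integral_flux_eq (hk : IsKernel k) {w : V → ℝ} {u : V → V} (hw : Periodic2 w)
    (hu : Periodic2 u) (hwm : Measurable w) (hw1 : IntegrableOn w Fund)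
    (hw2 : IntegrableOn (fun x => w x ^ 2) Fund)
    (hwu : IntegrableOn (fun x => w x • u x) Fund)
    (hwu2 : IntegrableOn (fun x => w x ^ 2 • u x) Fund)
    (hd : Differentiable ℝ u) (hdiv : ∀ x, div2 u x = 0) (x : V) :
    ∫ l, dot (grad2 k l) (u (x + l) - u x) * (w (x + l) - w x) ^ 2
      = dot (u x) (grad2 (conv k fun z => w z ^ 2) x) - div2 (conv k fun z => w z ^ 2 • u z) x
        + 4 * (1 / 2 * w x * div2 (conv k fun z => w z • u z) x
          - 1 / 2 * w x * dot (u x) (grad2 (conv k w) x)) := by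
  have hum : Measurable u := hd.continuous.measurable
  have p1 := hw.map fun a => a ^ 2
  have p2 := hw.map₂ hu fun a b => a • b
  have p3 := hw.map₂ hu fun a b => a ^ 2 • b
  rw [dot_grad2_conv hk p1 (hwm.pow_const 2) hw2, dot_grad2_conv hk hw hwm hw1,
    div2_conv hk p2 (hwm.smul hum) hwu, div2_conv hk p3 ((hwm.pow_const 2).smul hum) hwu2]
  have h0 : ∫ l, dot (grad2 k l) (u (x + l) - u x) = 0 :=
    integral_dot_grad2_eq_zero (F := fun l => u (x + l) - u x) hk
      ((hd.comp (differentiable_id.const_add x)).sub_const _)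
      fun l => by rw [div2_comp_add_sub, hdiv]
  have i0 : Integrable fun l => dot (grad2 k l) (u (x + l) - u x) :=
    integrable_dot_grad2 hk (F := fun y => u y - u x) (hu.map fun a => a - u x)
      (hum.sub_const _) (((hd.continuous.sub continuous_const).continuousOn.integrableOn_compact
        isCompact_Icc).mono_set Fund_subset_Icc) x
  have i1 := integrable_dot_grad2 hk p2 (hwm.smul hum) hwu x
  have i2 := integrable_dot_grad2 hk p3 ((hwm.pow_const 2).smul hum) hwu2 x
  have hc : ∀ f : V → ℝ, Periodic2 f → Measurable f → IntegrableOn f Fund →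
      Integrable fun l => dot (grad2 k l) (u x) * f (x + l) := by
    intro f hf hfm hfi
    refine integrable_mul_of_periodic (a := fun l => dot (grad2 k l) (u x)) ?_ ?_ hf hfm hfi x
    · have h1 := hk.continuous_fderiv_apply (1, 0)
      have h2 := hk.continuous_fderiv_apply (0, 1)
      simp only [dot, grad2]
      fun_prop
    · exact ((hk.hasCompactSupport_fderiv_apply (1, 0)).mul_right).add
        ((hk.hasCompactSupport_fderiv_apply (0, 1)).mul_right)
  have i3 := hc _ hw hwm hw1
  have i4 := hc _ p1 (hwm.pow_const 2) hw2
  have e : (fun l => dot (grad2 k l) (u (x + l) - u x) * (w (x + l) - w x) ^ 2) = fun l =>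
      dot (grad2 k l) (w (x + l) ^ 2 • u (x + l)) - dot (grad2 k l) (u x) * w (x + l) ^ 2
      - (2 * w x) * dot (grad2 k l) (w (x + l) • u (x + l))
      + (2 * w x) * (dot (grad2 k l) (u x) * w (x + l))
      + w x ^ 2 * dot (grad2 k l) (u (x + l) - u x) := by
    ext l
    simp only [dot, Prod.fst_sub, Prod.snd_sub, Prod.smul_fst, Prod.smul_snd, smul_eq_mul]
    ring
  rw [e, integral_linear_comb i2 i4 i1 i3 i0, h0]
  ring

end Kernel

section Stationary

variable {k : V → ℝ} {w : V → ℝ} {u : V → V}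

theorem contDiff_conv {E : Type*} [NormedAddCommGroup E] [NormedSpace ℝ E] [CompleteSpace E]
    (hk : IsKernel k) {f : V → E} (hf : LocallyIntegrable f) :
    ContDiff ℝ 1 (conv k f) :=
  hk.compactSupport.contDiff_convolution_left _ hk.contDiff_one hf

theorem continuous_grad2 {f : V → ℝ} (hf : ContDiff ℝ 1 f) : Continuous (grad2 f) :=
  ((hf.continuous_fderiv one_ne_zero).clm_apply continuous_const).prodMk
    ((hf.continuous_fderiv one_ne_zero).clm_apply continuous_const)

theorem continuous_div2 {F : V → V} (hF : ContDiff ℝ 1 F) : Continuous (div2 F) :=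
  ((hF.continuous_fderiv one_ne_zero).clm_apply continuous_const).fst.add
    ((hF.continuous_fderiv one_ne_zero).clm_apply continuous_const).snd

theorem Continuous.dot2 {X : Type*} [TopologicalSpace X] {f g : X → V} (hf : Continuous f)
    (hg : Continuous g) : Continuous fun x => dot (f x) (g x) :=
  (hf.fst.mul hg.fst).add (hf.snd.mul hg.snd)

theorem Continuous.integrableOn_Fund {E : Type*} [NormedAddCommGroup E] {f : V → E}
    (hf : Continuous f) : IntegrableOn f Fund :=
  (hf.continuousOn.integrableOn_compact isCompact_Icc).mono_set Fund_subset_Icc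

theorem integrableOn_mul_continuous {E : Type*} [NormedAddCommGroup E] [NormedSpace ℝ E]
    {f : V → ℝ} {g : V → E}
    (hf : IntegrableOn f Fund) (hg : Continuous g) : IntegrableOn (fun x => f x • g x) Fund := by
  have h : IntegrableOn f (Set.Icc 0 1) := hf.congr_set_ae Icc_ae_eq_Fund
  exact (h.smul_continuousOn hg.continuousOn isCompact_Icc).mono_set Fund_subset_Icc

/-- A periodic, measurable, square integrable vorticity together with its velocity. -/
structure IsSlice (w : V → ℝ) (u : V → V) : Prop where
  periodic : Periodic2 w
  measurable : Measurable w
  integrable : IntegrableOn w Fund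
  integrable_sq : IntegrableOn (fun x => w x ^ 2) Fund
  biotSavart : BiotSavart w u

theorem IsSlice.continuous (h : IsSlice w u) : Continuous u := h.biotSavart.differentiable.continuous

theorem IsSlice.locallyIntegrable (h : IsSlice w u) : LocallyIntegrable w :=
  h.periodic.locallyIntegrable h.measurable.aestronglyMeasurable h.integrable

theorem IsSlice.periodic_sq (h : IsSlice w u) : Periodic2 fun x => w x ^ 2 :=
  h.periodic.map fun a => a ^ 2

theorem IsSlice.periodic_smul (h : IsSlice w u) : Periodic2 fun x => w x • u x :=
  h.periodic.map₂ h.biotSavart.periodic fun a b => a • b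

theorem IsSlice.periodic_sq_smul (h : IsSlice w u) : Periodic2 fun x => w x ^ 2 • u x :=
  h.periodic.map₂ h.biotSavart.periodic fun a b => a ^ 2 • b

theorem IsSlice.locallyIntegrable_sq (h : IsSlice w u) : LocallyIntegrable fun x => w x ^ 2 :=
  h.periodic_sq.locallyIntegrable (h.measurable.pow_const 2).aestronglyMeasurable h.integrable_sq

theorem IsSlice.locallyIntegrable_smul (h : IsSlice w u) :
    LocallyIntegrable fun x => w x • u x :=
  h.periodic_smul.locallyIntegrable
    (h.measurable.smul h.continuous.measurable).aestronglyMeasurable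
    (integrableOn_mul_continuous h.integrable h.continuous)

theorem IsSlice.locallyIntegrable_sq_smul (h : IsSlice w u) :
    LocallyIntegrable fun x => w x ^ 2 • u x :=
  h.periodic_sq_smul.locallyIntegrable
    ((h.measurable.pow_const 2).smul h.continuous.measurable).aestronglyMeasurable
    (integrableOn_mul_continuous h.integrable_sq h.continuous)

/-- The regularized enstrophy defect `½ω ∇·[(ωu)_ε] − ½ω (u·∇)ω_ε`. -/
def defect (k w : V → ℝ) (u : V → V) (x : V) : ℝ :=
  1 / 2 * w x * div2 (conv k fun z => w z • u z) x
    - 1 / 2 * w x * dot (u x) (grad2 (conv k w) x)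

theorem IsSlice.integrableOn_defect (h : IsSlice w u) (hk : IsKernel k) {χ : V → ℝ}
    (hχ : Continuous χ) : IntegrableOn (fun x => χ x * defect k w u x) Fund := by
  have c1 := continuous_div2 (contDiff_conv hk h.locallyIntegrable_smul)
  have c2 := h.continuous.dot2 (continuous_grad2 (contDiff_conv hk h.locallyIntegrable))
  refine (integrableOn_mul_continuous h.integrable
    ((hχ.mul (c1.sub c2)).const_mul (1 / 2))).congr_fun (fun x _ => ?_) measurableSet_Fund
  simp only [defect, smul_eq_mul, Pi.mul_apply, Pi.sub_apply]
  ring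

/-- The spatial flux `(ω²)_ε u − (ω²u)_ε`. -/
def spaceFlux (k w : V → ℝ) (u : V → V) (x : V) : V :=
  conv k (fun z => w z ^ 2) x • u x - conv k (fun z => w z ^ 2 • u z) x

theorem IsSlice.integral_flux (h : IsSlice w u) (hk : IsKernel k) {χ : V → ℝ} (hχ : ContDiff ℝ 1 χ)
    (hχp : Periodic2 χ) :
    ∫ x in Fund, χ x * ∫ l, dot (grad2 k l) (u (x + l) - u x) * (w (x + l) - w x) ^ 2
      = -(∫ x in Fund, dot (grad2 χ x) (spaceFlux k w u x))
        + 4 * ∫ x in Fund, χ x * defect k w u x := by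
  have hu := h.biotSavart.differentiable
  have d1 := contDiff_conv hk h.locallyIntegrable_sq
  have d2 := contDiff_conv hk h.locallyIntegrable_sq_smul
  have hG : Differentiable ℝ (spaceFlux k w u) :=
    ((d1.differentiable one_ne_zero).smul hu).sub (d2.differentiable one_ne_zero)
  have hdiv : ∀ x, div2 (spaceFlux k w u) x
      = dot (u x) (grad2 (conv k fun z => w z ^ 2) x) - div2 (conv k fun z => w z ^ 2 • u z) x := by
    intro x
    unfold spaceFlux
    rw [div2_sub (((d1.differentiable one_ne_zero) x).fun_smul (hu x))
      (d2.differentiable one_ne_zero x), div2_smul (d1.differentiable one_ne_zero x) (hu x),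
      h.biotSavart.divfree]
    simp only [dot]
    ring
  have hcdiv : Continuous (div2 (spaceFlux k w u)) := by
    rw [funext hdiv]
    exact (h.continuous.dot2 (continuous_grad2 d1)).sub (continuous_div2 d2)
  have hGp : Periodic2 (spaceFlux k w u) :=
    ((h.periodic_sq.conv).map₂ h.biotSavart.periodic fun a b => a • b).map₂
      h.periodic_sq_smul.conv fun a b => a - b
  have e1 : ∀ x, χ x * ∫ l, dot (grad2 k l) (u (x + l) - u x) * (w (x + l) - w x) ^ 2
      = χ x * div2 (spaceFlux k w u) x + 4 * (χ x * defect k w u x) := by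
    intro x
    rw [integral_flux_eq hk h.periodic h.biotSavart.periodic h.measurable h.integrable
      h.integrable_sq (integrableOn_mul_continuous h.integrable h.continuous)
      (integrableOn_mul_continuous h.integrable_sq h.continuous) hu h.biotSavart.divfree,
      hdiv, defect]
    ring
  have i1 : IntegrableOn (fun x => χ x * div2 (spaceFlux k w u) x) Fund :=
    (hχ.continuous.mul hcdiv).integrableOn_Fund
  have i2 : IntegrableOn (fun x => dot (grad2 χ x) (spaceFlux k w u x)) Fund :=
    ((continuous_grad2 hχ).dot2 hG.continuous).integrableOn_Fund
  have e2 : (div2 fun y => χ y • spaceFlux k w u y)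
      = fun x => dot (grad2 χ x) (spaceFlux k w u x) + χ x * div2 (spaceFlux k w u) x :=
    funext fun x => div2_smul (hχ.differentiable one_ne_zero x) (hG x)
  have h0 := setIntegral_div2_Fund ((hχ.differentiable one_ne_zero).fun_smul hG)
    (hχp.map₂ hGp fun a b => a • b) (by rw [e2]; exact i2.add i1)
  rw [e2, integral_add i2 i1] at h0
  simp only [e1]
  rw [integral_add i1 ((h.integrableOn_defect hk hχ.continuous).const_mul 4), integral_const_mul]
  linarith

end Stationary

section Scaled

variable {φ : V → ℝ}

theorem IsMollifier.isKernel_scaled (hφ : IsMollifier φ) (heven : ∀ x, φ (-x) = φ x) {ε : ℝ}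
    (hε : 0 < ε) : IsKernel (scaled φ ε) where
  smooth := contDiff_const.mul (hφ.smooth.comp (contDiff_const_smul _))
  compactSupport := (hφ.compactSupport.comp_homeomorph
    (Homeomorph.smulOfNeZero ε⁻¹ (inv_ne_zero hε.ne'))).mul_left
  even x := by simp [scaled, heven]

theorem IsMollifier.scaled_nonneg (hφ : IsMollifier φ) {ε : ℝ} (x : V) : 0 ≤ scaled φ ε x :=
  mul_nonneg (sq_nonneg _) (hφ.nonneg _)

theorem IsMollifier.integral_scaled (hφ : IsMollifier φ) {ε : ℝ} (hε : 0 < ε) :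
    ∫ x, scaled φ ε x = 1 := by
  simp only [scaled]
  rw [integral_const_mul, Measure.integral_comp_smul, hφ.unit_integral]
  have : Module.finrank ℝ V = 2 := by simp [V]
  rw [this, abs_of_nonneg (by positivity)]
  field_simp
  simp

/-- The scaled mollifiers concentrate at the origin. -/
theorem IsMollifier.exists_scaled_eq_zero (hφ : IsMollifier φ) :
    ∃ C : ℝ, 0 < C ∧ ∀ ε > 0, ∀ x, C * ε ≤ ‖x‖ → scaled φ ε x = 0 := by
  obtain ⟨R, hR⟩ := hφ.compactSupport.isCompact.isBounded.subset_ball 0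
  refine ⟨max R 1, by positivity, fun ε hε x hx => ?_⟩
  simp only [scaled, mul_eq_zero]
  right
  by_contra h
  have := hR (subset_tsupport φ h)
  rw [mem_ball_zero_iff, norm_smul, norm_inv, Real.norm_of_nonneg hε.le, inv_mul_lt_iff₀ hε] at this
  nlinarith [le_max_left R 1]

end Scaled

section RadialKernel

/-- The squared Euclidean length. -/
def normSq2 (x : V) : ℝ := x.1 ^ 2 + x.2 ^ 2

theorem contDiff_normSq2 {n : WithTop ℕ∞} : ContDiff ℝ n normSq2 :=
  (contDiff_fst.pow 2).add (contDiff_snd.pow 2)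

theorem hasFDerivAt_normSq2 (x : V) :
    HasFDerivAt normSq2 ((2 * x.1) • ContinuousLinearMap.fst ℝ ℝ ℝ
      + (2 * x.2) • ContinuousLinearMap.snd ℝ ℝ ℝ) x := by
  have h1 := (hasFDerivAt_fst (𝕜 := ℝ) (p := x)).pow 2
  have h2 := (hasFDerivAt_snd (𝕜 := ℝ) (p := x)).pow 2
  refine (h1.add h2).congr_fderiv ?_
  simp

theorem hasCompactSupport_comp_normSq2 {E : Type*} [Zero E] {f : V → E} {R : ℝ}
    (h : ∀ x, R ≤ normSq2 x → f x = 0) : HasCompactSupport f := by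
  refine HasCompactSupport.intro (isCompact_closedBall (0 : V) (R + 1)) fun x hx => h x ?_
  rw [mem_closedBall_zero_iff, not_le] at hx
  by_contra hlt
  push Not at hlt
  unfold normSq2 at hlt
  have hR : 0 < R := lt_of_le_of_lt (by positivity) hlt
  rcases lt_max_iff.1 (show R + 1 < max ‖x.1‖ ‖x.2‖ from hx) with h | h
  · have := sq_abs x.1
    rw [Real.norm_eq_abs] at h
    nlinarith [sq_nonneg x.2]
  · have := sq_abs x.2
    rw [Real.norm_eq_abs] at h
    nlinarith [sq_nonneg x.1]

theorem fderiv_radial {h : ℝ → ℝ} (hh : Differentiable ℝ h) (x v : V) :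
    fderiv ℝ (fun y => h (normSq2 y) • y) x v
      = h (normSq2 x) • v + (deriv h (normSq2 x) * (2 * x.1 * v.1 + 2 * x.2 * v.2)) • x := by
  have h1 := (hh (normSq2 x)).hasDerivAt.comp_hasFDerivAt x (hasFDerivAt_normSq2 x)
  have h2 := (h1.smul (hasFDerivAt_id x)).fderiv
  erw [h2]
  simp
  ring_nf

theorem curl2_radial {h : ℝ → ℝ} (hh : Differentiable ℝ h) (x : V) :
    curl2 (fun y => h (normSq2 y) • y) x = 0 := by
  simp only [curl2, fderiv_radial hh]
  simp
  ring

theorem div2_radial {h : ℝ → ℝ} (hh : Differentiable ℝ h) (x : V) :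
    div2 (fun y => h (normSq2 y) • y) x
      = 2 * h (normSq2 x) + 2 * normSq2 x * deriv h (normSq2 x) := by
  simp only [div2, fderiv_radial hh]
  simp [normSq2]
  ring

/-- A smooth cutoff equal to `1` on `(-∞, 1]` and to `0` on `[2, ∞)`. -/
def cutoff (s : ℝ) : ℝ := Real.smoothTransition (2 - s)

theorem contDiff_cutoff {n : WithTop ℕ∞} (hn : n ≤ (⊤ : ℕ∞)) : ContDiff ℝ n cutoff :=
  (Real.smoothTransition.contDiff (n := (⊤ : ℕ∞)).of_le hn).comp (contDiff_const.sub contDiff_id)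

theorem cutoff_of_le {s : ℝ} (hs : s ≤ 1) : cutoff s = 1 :=
  Real.smoothTransition.one_of_one_le (by linarith)

theorem cutoff_of_ge {s : ℝ} (hs : 2 ≤ s) : cutoff s = 0 :=
  Real.smoothTransition.zero_of_nonpos (by linarith)

theorem antitone_cutoff : Antitone cutoff := fun _ _ h =>
  Real.smoothTransition.monotone (by linarith)

theorem contDiff_deriv_cutoff : ContDiff ℝ 1 (deriv cutoff) :=
  (contDiff_infty_iff_deriv.1 (contDiff_cutoff le_rfl)).2.of_le (by exact_mod_cast le_top)

theorem deriv_cutoff_of_gt {s : ℝ} (hs : 2 < s) : deriv cutoff s = 0 := by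
  have : cutoff =ᶠ[𝓝 s] fun _ => 0 := by
    filter_upwards [lt_mem_nhds hs] with x hx using cutoff_of_ge hx.le
  rw [this.deriv_eq, deriv_const]

/-- The radial profile `(b(s/4) - b(s)) / (2s)` of the dyadic kernel. -/
def dyadicProfile (s : ℝ) : ℝ := (cutoff (s / 4) - cutoff s) / (2 * s)

theorem dyadicProfile_of_lt {s : ℝ} (hs : s < 1) : dyadicProfile s = 0 := by
  rw [dyadicProfile, cutoff_of_le hs.le]
  rcases le_or_gt s 0 with h | h
  · rw [cutoff_of_le (by linarith)]; simp
  · rw [cutoff_of_le (by linarith)]; simp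

theorem contDiff_dyadicProfile : ContDiff ℝ 1 dyadicProfile := by
  rw [contDiff_iff_contDiffAt]
  intro s
  rcases eq_or_ne s 0 with rfl | hs
  · refine (contDiffAt_const (c := (0 : ℝ))).congr_of_eventuallyEq ?_
    filter_upwards [gt_mem_nhds zero_lt_one] with x hx using dyadicProfile_of_lt hx
  · have hc : ContDiff ℝ 1 cutoff := contDiff_cutoff (by exact_mod_cast le_top)
    exact ((hc.comp (contDiff_id.div_const 4)).sub hc).contDiffAt.div
      (contDiff_const.mul contDiff_id).contDiffAt (by simpa using hs)

theorem two_mul_dyadicProfile (s : ℝ) :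
    2 * s * dyadicProfile s = cutoff (s / 4) - cutoff s := by
  rcases eq_or_ne s 0 with rfl | hs
  · simp
  · rw [dyadicProfile]; field_simp

theorem deriv_dyadicProfile (s : ℝ) :
    2 * dyadicProfile s + 2 * s * deriv dyadicProfile s
      = 1 / 4 * deriv cutoff (s / 4) - deriv cutoff s := by
  have hc : Differentiable ℝ cutoff :=
    (contDiff_cutoff (n := 1) (by exact_mod_cast le_top)).differentiable one_ne_zero
  have h1 := (((hasDerivAt_id s).const_mul 2).mul
    (contDiff_dyadicProfile.differentiable one_ne_zero s).hasDerivAt)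
  have h2 := ((hc (s / 4)).hasDerivAt.comp s ((hasDerivAt_id s).div_const 4)).sub
    (hc s).hasDerivAt
  have e : (fun y : ℝ => 2 * y) * dyadicProfile = (cutoff ∘ fun y => y / 4) - cutoff :=
    funext two_mul_dyadicProfile
  have := h1.unique (by simpa [e] using h2 :
    HasDerivAt ((fun y : ℝ => 2 * y) * dyadicProfile) (deriv cutoff (s / 4) * (1 / 4)
      - deriv cutoff s) s)
  simp at this
  linarith

theorem exists_dyadic_kernel : ∃ (ρ : V → ℝ) (m : V → V),
    ContDiff ℝ 1 ρ ∧ HasCompactSupport ρ ∧ 0 < ∫ x, ρ x ∧ ContDiff ℝ 1 m ∧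
    HasCompactSupport m ∧ (∀ x, curl2 m x = 0) ∧
    ∀ x, div2 m x = ρ x - 1 / 4 * ρ ((1 / 2 : ℝ) • x) := by
  have hρ : ContDiff ℝ 1 fun x => -deriv cutoff (normSq2 x) :=
    (contDiff_deriv_cutoff.comp contDiff_normSq2).neg
  have hs : HasCompactSupport fun x => -deriv cutoff (normSq2 x) :=
    hasCompactSupport_comp_normSq2 (R := 3) fun x hx => by
      rw [deriv_cutoff_of_gt (by linarith), neg_zero]
  refine ⟨fun x => -deriv cutoff (normSq2 x), fun x => dyadicProfile (normSq2 x) • x, hρ, hs, ?_,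
    (contDiff_dyadicProfile.comp contDiff_normSq2).smul contDiff_id,
    hasCompactSupport_comp_normSq2 (R := 8) fun x hx => ?_,
    curl2_radial (contDiff_dyadicProfile.differentiable one_ne_zero), fun x => ?_⟩
  · have h0 : 0 ≤ fun x => -deriv cutoff (normSq2 x) := fun x => by
      have := antitone_cutoff.deriv_nonpos (x := normSq2 x)
      simpa using this
    rw [integral_pos_iff_support_of_nonneg h0 (hρ.continuous.integrable_of_hasCompactSupport hs)]
    refine hρ.continuous.isOpen_support.measure_pos _ ?_
    by_contra hne
    rw [Set.not_nonempty_iff_eq_empty, Function.support_eq_empty_iff] at hne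
    have hd : ∀ s ∈ Set.Ioo (0 : ℝ) 3, deriv cutoff s = 0 := fun s hs' => by
      have := congrFun hne (√s, 0)
      simpa [normSq2, Real.sq_sqrt hs'.1.le] using this
    have hc : Differentiable ℝ cutoff :=
      (contDiff_cutoff (n := 1) (by exact_mod_cast le_top)).differentiable one_ne_zero
    obtain ⟨s, hs', h⟩ := exists_deriv_eq_slope cutoff (show (0 : ℝ) < 3 by norm_num)
      hc.continuous.continuousOn hc.differentiableOn
    rw [hd s hs', cutoff_of_le zero_le_one, cutoff_of_ge (s := 3) (by norm_num)] at h
    norm_num at h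
  · rw [dyadicProfile, cutoff_of_ge (by linarith), cutoff_of_ge (by linarith)]
    simp
  · rw [div2_radial (contDiff_dyadicProfile.differentiable one_ne_zero), deriv_dyadicProfile]
    have : normSq2 ((1 / 2 : ℝ) • x) = normSq2 x / 4 := by
      simp [normSq2]; ring
    simp only [this]
    ring

end RadialKernel

section DivCurl

/-- Rotation by a right angle. -/
def rot (a : V) : V := (a.2, -a.1)

theorem continuous_rot : Continuous rot := continuous_snd.prodMk continuous_fst.neg

/-- The product of two planar fields, one of them conjugated, as complex numbers. -/
def cmul (a b : V) : V := (a.1 * b.1 - a.2 * b.2, a.1 * b.2 + a.2 * b.1)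

theorem hasFDerivAt_cmul {m v : V → V} (hm : Differentiable ℝ m) (hv : Differentiable ℝ v) (x : V) :
    Differentiable ℝ (fun y => cmul (m y) (v y)) ∧ ∀ w,
      fderiv ℝ (fun y => cmul (m y) (v y)) x w
        = cmul (fderiv ℝ m x w) (v x) + cmul (m x) (fderiv ℝ v x w) := by
  have h : ∀ x, HasFDerivAt (fun y => cmul (m y) (v y)) _ x := fun x =>
    (((hasFDerivAt_fst_comp hm x).mul (hasFDerivAt_fst_comp hv x)).sub
      ((hasFDerivAt_snd_comp hm x).mul (hasFDerivAt_snd_comp hv x))).prodMk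
    (((hasFDerivAt_fst_comp hm x).mul (hasFDerivAt_snd_comp hv x)).add
      ((hasFDerivAt_snd_comp hm x).mul (hasFDerivAt_fst_comp hv x)))
  refine ⟨fun x => (h x).differentiableAt, fun w => ?_⟩
  rw [(h x).fderiv]
  ext <;> simp [cmul] <;> ring

theorem differentiable_rot_comp {F : V → V} (hF : Differentiable ℝ F) :
    Differentiable ℝ fun y => rot (F y) :=
  hF.snd.prodMk hF.fst.neg

theorem fderiv_rot_comp {F : V → V} (hF : Differentiable ℝ F) (x w : V) :
    fderiv ℝ (fun y => rot (F y)) x w = rot (fderiv ℝ F x w) := by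
  have h : HasFDerivAt (fun y => rot (F y)) _ x :=
    (hasFDerivAt_snd_comp hF x).prodMk (hasFDerivAt_fst_comp hF x).neg
  rw [h.fderiv]
  simp [rot]

variable {m v : V → V} {ζ : V → ℝ}

theorem div2_cmul (hm : Differentiable ℝ m) (hv : Differentiable ℝ v) (hc : ∀ x, curl2 m x = 0)
    (hd : ∀ x, div2 v x = 0) (x : V) :
    div2 (fun y => cmul (m y) (v y)) x = div2 m x * (v x).1 - curl2 v x * (m x).2 := by
  have h1 := hc x
  have h2 := hd x
  simp only [div2, curl2, (hasFDerivAt_cmul hm hv x).2] at *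
  simp only [cmul, Prod.fst_add, Prod.snd_add]
  linear_combination -(v x).2 * h1 + (m x).1 * h2

theorem div2_rot_cmul (hm : Differentiable ℝ m) (hv : Differentiable ℝ v)
    (hc : ∀ x, curl2 m x = 0) (hd : ∀ x, div2 v x = 0) (x : V) :
    div2 (fun y => rot (cmul (m y) (v y))) x = div2 m x * (v x).2 + curl2 v x * (m x).1 := by
  have h1 := hc x
  have h2 := hd x
  simp only [div2, curl2] at *
  rw [fderiv_rot_comp (hasFDerivAt_cmul hm hv x).1, fderiv_rot_comp (hasFDerivAt_cmul hm hv x).1]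
  simp only [(hasFDerivAt_cmul hm hv x).2]
  simp only [cmul, rot, Prod.fst_add, Prod.snd_add]
  linear_combination (v x).1 * h1 + (m x).2 * h2

/-- Integrating a divergence-free field against the divergence of a curl-free one only sees
its curl. -/
theorem integral_div2_smul_eq (hm : ContDiff ℝ 1 m) (hs : HasCompactSupport m)
    (hc : ∀ x, curl2 m x = 0) (hv : Differentiable ℝ v) (hd : ∀ x, div2 v x = 0)
    (hζ : ∀ x, curl2 v x = ζ x) (hi : LocallyIntegrable ζ) :
    ∫ y, div2 m y • v y = ∫ y, ζ y • rot (m y) := by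
  have hmd := hm.differentiable one_ne_zero
  have hsd : HasCompactSupport (div2 m) := by
    have h1 : HasCompactSupport fun x => fderiv ℝ m x (1, 0) := hs.fderiv_apply (𝕜 := ℝ) (1, 0)
    have h2 : HasCompactSupport fun x => fderiv ℝ m x (0, 1) := hs.fderiv_apply (𝕜 := ℝ) (0, 1)
    exact (h1.comp_left (g := Prod.fst) rfl).add (h2.comp_left (g := Prod.snd) rfl)
  have i1 : Integrable fun y => div2 m y • v y :=
    ((continuous_div2 hm).smul hv.continuous).integrable_of_hasCompactSupport hsd.smul_right
  have i2 : Integrable fun y => ζ y • rot (m y) :=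
    hi.integrable_smul_right_of_hasCompactSupport (continuous_rot.comp hm.continuous)
      (hs.comp_left (g := rot) (by simp [rot]))
  have hF := (hasFDerivAt_cmul hmd hv 0).1
  have sF : HasCompactSupport fun y => cmul (m y) (v y) := by
    refine hs.mono fun x hx => ?_
    contrapose! hx
    simp at hx
    simp [hx, cmul]
  have e1 : (div2 fun y => cmul (m y) (v y)) = fun y => (div2 m y • v y).1 - (ζ y • rot (m y)).1 :=
    funext fun y => by rw [div2_cmul hmd hv hc hd, hζ]; rfl
  have e2 : (div2 fun y => rot (cmul (m y) (v y)))
      = fun y => (div2 m y • v y).2 - (ζ y • rot (m y)).2 :=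
    funext fun y => by rw [div2_rot_cmul hmd hv hc hd, hζ]; simp [rot]
  have h1 := integral_div2_eq_zero hF sF (by rw [e1]; exact i1.fst.sub i2.fst)
  have h2 := integral_div2_eq_zero (differentiable_rot_comp hF)
    (sF.comp_left (g := rot) (by simp [rot])) (by rw [e2]; exact i1.snd.sub i2.snd)
  rw [e1, integral_sub i1.fst i2.fst, ← fst_integral i1, ← fst_integral i2] at h1
  rw [e2, integral_sub i1.snd i2.snd, ← snd_integral i1, ← snd_integral i2] at h2
  exact Prod.ext (sub_eq_zero.1 h1) (sub_eq_zero.1 h2)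

end DivCurl

section Dyadic

variable {ρ : V → ℝ} {m : V → V} {w : V → ℝ} {u : V → V}

theorem fderiv_comp_add_smul {u : V → V} (hu : Differentiable ℝ u) (x : V) (r : ℝ) (y v : V) :
    fderiv ℝ (fun y => u (x + r • y)) y v = r • fderiv ℝ u (x + r • y) v := by
  have h : HasFDerivAt (fun y : V => x + r • y) (r • ContinuousLinearMap.id ℝ V) y :=
    ((hasFDerivAt_id y).const_smul r).const_add x
  have := ((hu (x + r • y)).hasFDerivAt.comp y h).fderiv
  simp only [Function.comp_def] at this
  rw [this]
  simp

/-- The average of `u` at scale `r`. -/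
def scaleAvg (ρ : V → ℝ) (u : V → V) (r : ℝ) (x : V) : V := ∫ y, ρ y • u (x + r • y)

theorem locallyIntegrable_comp_add_smul {w : V → ℝ} (hw : LocallyIntegrable w) (x : V) {r : ℝ}
    (hr : r ≠ 0) : LocallyIntegrable fun y => w (x + r • y) := by
  rw [locallyIntegrable_iff] at *
  intro K hK
  have hS : IsCompact ((fun y : V => x + r • y) '' K) := hK.image (by fun_prop)
  have h1 := (((hw _ hS).integrable_indicator hS.measurableSet).comp_add_left x).comp_smul hr
  refine (h1.integrableOn (s := K)).congr_fun (fun y hy => ?_) hK.measurableSet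
  exact Set.indicator_of_mem (Set.mem_image_of_mem _ hy) _

theorem scaleAvg_sub (hρ : Continuous ρ) (hρs : HasCompactSupport ρ)
    (hm : ContDiff ℝ 1 m) (hs : HasCompactSupport m)
    (hc : ∀ x, curl2 m x = 0) (hd : ∀ x, div2 m x = ρ x - 1 / 4 * ρ ((1 / 2 : ℝ) • x))
    (h : IsSlice w u) {r : ℝ} (hr : 0 < r) (x : V) :
    scaleAvg ρ u r x - scaleAvg ρ u (2 * r) x = r • ∫ y, w (x + r • y) • rot (m y) := by
  have hu := h.biotSavart.differentiable
  have hv : Differentiable ℝ fun y => u (x + r • y) :=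
    hu.comp ((differentiable_id.const_smul r).const_add x)
  have i : ∀ s : ℝ, Integrable fun y => ρ y • u (x + s • y) := fun s =>
    (hρ.smul (hu.continuous.comp (by fun_prop))).integrable_of_hasCompactSupport hρs.smul_right
  have e := integral_div2_smul_eq (ζ := fun y => r * w (x + r • y)) hm hs hc hv
    (fun y => by
      have := h.biotSavart.divfree (x + r • y)
      simp only [div2, fderiv_comp_add_smul hu, Prod.smul_fst, Prod.smul_snd, smul_eq_mul] at *
      rw [← mul_add, this, mul_zero])
    (fun y => by
      have := h.biotSavart.curl_eq (x + r • y)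
      simp only [curl2, fderiv_comp_add_smul hu, Prod.smul_fst, Prod.smul_snd, smul_eq_mul] at *
      rw [← mul_sub, this])
    ((locallyIntegrable_comp_add_smul h.locallyIntegrable x hr.ne').smul r)
  have e2 : scaleAvg ρ u (2 * r) x = ∫ y, (1 / 4 * ρ ((1 / 2 : ℝ) • y)) • u (x + r • y) := by
    have := Measure.integral_comp_smul (volume : Measure V)
      (fun y => ρ y • u (x + (2 * r) • y)) (1 / 2 : ℝ)
    have hfr : Module.finrank ℝ V = 2 := by simp [V]
    rw [hfr] at this
    simp only [mul_smul, integral_smul]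
    rw [scaleAvg]
    simp only [smul_smul] at this
    rw [show 2 * r * (1 / 2) = r by ring] at this
    rw [this, smul_smul, abs_of_nonneg (by positivity)]
    norm_num
  have i2 : Integrable fun y => (1 / 4 * ρ ((1 / 2 : ℝ) • y)) • u (x + r • y) := by
    refine ((continuous_const.mul (hρ.comp (continuous_const_smul _))).smul
      hv.continuous).integrable_of_hasCompactSupport (HasCompactSupport.smul_right ?_)
    exact (hρs.comp_homeomorph (Homeomorph.smulOfNeZero (1 / 2 : ℝ) (by norm_num))).mul_left
  rw [e2, scaleAvg, ← integral_sub (i r) i2]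
  simp_rw [← sub_smul, ← hd, e, mul_smul]
  rw [integral_smul]

end Dyadic

section DyadicBounds

variable {ρ : V → ℝ} {m : V → V}

theorem setIntegral_comp_add_of_mean_zero {u : V → V} (hu : Periodic2 u)
    (h0 : ∫ x in Fund, u x = 0) (z : V) : ∫ s in Fund, u (z + s) = 0 := by
  simp only [add_comm z]
  rw [setIntegral_translate isAddFundamentalDomain_Fund hu.vadd z, h0]

/-- Averages of a mean-zero periodic field decay at large scales. -/
theorem exists_norm_scaleAvg_le (hρ : ContDiff ℝ 1 ρ) (hρs : HasCompactSupport ρ) :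
    ∃ L : ℝ, 0 ≤ L ∧ ∀ u : V → V, Continuous u → Periodic2 u → ∫ x in Fund, u x = 0 →
      ∀ U : ℝ, (∀ x, ‖u x‖ ≤ U) → ∀ r : ℝ, 1 ≤ r → ∀ x, ‖scaleAvg ρ u r x‖ ≤ L / r * U := by
  obtain ⟨K, hK⟩ := hρ.lipschitzWith_of_hasCompactSupport hρs one_ne_zero
  obtain ⟨R, hR⟩ := hρs.isCompact.isBounded.subset_closedBall 0
  set B : Set V := Metric.closedBall 0 (R + 1) with hB
  have hBf : volume B ≠ ⊤ := measure_closedBall_lt_top.ne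
  refine ⟨K * volume.real B, by positivity, fun u hu hp h0 U hU r hr x => ?_⟩
  have hr0 : 0 < r := by linarith
  have hU0 : 0 ≤ U := (norm_nonneg _).trans (hU 0)
  have hzero : ∀ y, y ∉ Metric.closedBall (0 : V) R → ρ y = 0 := fun y hy => by
    by_contra h
    exact hy (hR (subset_tsupport ρ h))
  have hint : ∀ g : V → ℝ, Continuous g → HasCompactSupport g → ∀ s : V,
      Integrable fun y => g y • u (x + r • y + s) := fun g hg hgs s =>
    (hg.smul (hu.comp (by fun_prop))).integrable_of_hasCompactSupport hgs.smul_right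
  have hshift : ∀ s, Continuous (fun y : V => ρ (y + s)) ∧
      HasCompactSupport fun y : V => ρ (y + s) := fun s =>
    ⟨hρ.continuous.comp (by fun_prop), hρs.comp_homeomorph (Homeomorph.addRight s)⟩
  have e1 : ∀ s : V, scaleAvg ρ u r x = ∫ y, ρ (y + r⁻¹ • s) • u (x + r • y + s) := by
    intro s
    rw [scaleAvg, ← integral_add_right_eq_self _ (r⁻¹ • s)]
    simp [smul_smul, hr0.ne', add_assoc]
  have i1 : Integrable (fun q : V × V => ρ q.2 • u (x + r • q.2 + q.1))
      ((volume.restrict Fund).prod volume) := by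
    have h : Integrable (fun q : V × V => ρ q.2) ((volume.restrict Fund).prod volume) :=
      (hρ.continuous.integrable_of_hasCompactSupport hρs).comp_snd μT
    refine h.smul_bdd U ?_ (Eventually.of_forall fun q => hU _)
    exact (hu.comp (by fun_prop)).aestronglyMeasurable
  have e2 : ∫ s in Fund, ∫ y, ρ y • u (x + r • y + s) = 0 := by
    rw [integral_integral_swap i1]
    simp only [integral_smul, setIntegral_comp_add_of_mean_zero hp h0, smul_zero, integral_zero]
  have e3 : scaleAvg ρ u r x
      = ∫ s in Fund, ∫ y, (ρ (y + r⁻¹ • s) - ρ y) • u (x + r • y + s) := by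
    have hi2 : IntegrableOn (fun s => ∫ y, ρ y • u (x + r • y + s)) Fund := i1.integral_prod_left
    have h := integral_sub (integrable_const (scaleAvg ρ u r x) (μ := μT)) hi2
    rw [integral_const, probReal_univ, one_smul, μT, e2, sub_zero] at h
    rw [← h]
    refine setIntegral_congr_fun measurableSet_Fund fun s _ => ?_
    rw [e1 s, ← integral_sub (hint _ (hshift _).1 (hshift _).2 s) (hint _ hρ.continuous hρs s)]
    simp only [sub_smul]
  have hb : ∀ s ∈ Fund, ‖∫ y, (ρ (y + r⁻¹ • s) - ρ y) • u (x + r • y + s)‖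
      ≤ K * volume.real B / r * U := by
    intro s hs
    have hs1 : ‖r⁻¹ • s‖ ≤ 1 / r := by
      have h1 : ‖s‖ ≤ 1 := by
        obtain ⟨h1, h2⟩ := hs
        refine max_le ?_ ?_ <;> rw [Real.norm_eq_abs, abs_of_nonneg] <;>
          first | exact h1.1 | exact h2.1 | exact h1.2.le | exact h2.2.le
      rw [norm_smul, norm_inv, Real.norm_of_nonneg hr0.le, inv_eq_one_div]
      exact mul_le_of_le_one_right (by positivity) h1
    have hr1 : 1 / r ≤ 1 := by rw [div_le_one hr0]; exact hr
    have e : ∫ y, (ρ (y + r⁻¹ • s) - ρ y) • u (x + r • y + s)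
        = ∫ y in B, (ρ (y + r⁻¹ • s) - ρ y) • u (x + r • y + s) := by
      refine (setIntegral_eq_integral_of_forall_compl_eq_zero fun y hy => ?_).symm
      rw [hB, mem_closedBall_zero_iff, not_le] at hy
      rw [hzero y (by rw [mem_closedBall_zero_iff]; linarith), hzero, sub_zero, zero_smul]
      rw [mem_closedBall_zero_iff, not_le]
      have := norm_sub_le (y + r⁻¹ • s) (r⁻¹ • s)
      rw [add_sub_cancel_right] at this
      linarith
    rw [e]
    refine (norm_setIntegral_le_of_norm_le_const (C := K * (1 / r) * U) hBf.lt_top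
      fun y _ => ?_).trans (le_of_eq ?_)
    · rw [norm_smul]
      refine mul_le_mul ?_ (hU _) (norm_nonneg _) (by positivity)
      have := hK.dist_le_mul (y + r⁻¹ • s) y
      rw [dist_eq_norm, dist_eq_norm, add_sub_cancel_left] at this
      exact this.trans (by gcongr)
    · ring
  rw [e3]
  refine (norm_setIntegral_le_of_norm_le_const (by rw [volume_Fund]; simp) hb).trans ?_
  simp [measureReal_def, volume_Fund]

theorem setLIntegral_comp_add_smul_le {R r₀ : ℝ} :
    ∃ N : ℕ, ∀ F : V → ℝ≥0∞, Measurable F → Periodic2 F → ∀ r, 0 < r → r ≤ r₀ → ∀ x,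
      ∫⁻ y in Metric.closedBall (0 : V) R, F (x + r • y)
        ≤ ENNReal.ofReal (r ^ 2)⁻¹ * (N * ∫⁻ y in Fund, F y) := by
  obtain ⟨N, hN⟩ := exists_setLIntegral_le (Metric.isBounded_closedBall (x := (0 : V)) (r := r₀ * R))
  refine ⟨N, fun F hF hp r hr hr₀ x => ?_⟩
  have hm := Measure.map_addHaar_smul (volume : Measure V) hr.ne'
  have hfr : Module.finrank ℝ V = 2 := by simp [V]
  rw [hfr, abs_of_nonneg (by positivity)] at hm
  set S : Set V := Metric.closedBall 0 (r₀ * R)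
  have hS : MeasurableSet S := measurableSet_closedBall
  calc ∫⁻ y in Metric.closedBall (0 : V) R, F (x + r • y)
      ≤ ∫⁻ y, S.indicator (fun z => F (x + z)) (r • y) := by
        rw [← lintegral_indicator measurableSet_closedBall]
        refine lintegral_mono fun y => ?_
        by_cases hy : y ∈ Metric.closedBall (0 : V) R
        · have hz : r • y ∈ S := by
            rw [mem_closedBall_zero_iff] at hy ⊢
            rw [norm_smul, Real.norm_of_nonneg hr.le]
            exact mul_le_mul hr₀ hy (norm_nonneg _) (hr.le.trans hr₀)
          rw [Set.indicator_of_mem hy, Set.indicator_of_mem hz]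
        · rw [Set.indicator_of_notMem hy]
          exact zero_le
    _ = ∫⁻ z, S.indicator (fun z => F (x + z)) z ∂(Measure.map (r • ·) volume) := by
        have hG : Measurable fun z => F (x + z) := hF.comp (measurable_const_add x)
        rw [lintegral_map (hG.indicator hS) (measurable_const_smul r)]
    _ = ENNReal.ofReal (r ^ 2)⁻¹ * ∫⁻ z in S, F (x + z) := by
        rw [hm, lintegral_smul_measure, lintegral_indicator hS, smul_eq_mul]
    _ ≤ _ := by gcongr; exact hN F hp x

theorem exists_enorm_dyadic_le (hm : Continuous m) (hs : HasCompactSupport m) {p : ℝ} (hp : 1 ≤ p)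
    (r₀ : ℝ) : ∃ C : ℝ≥0, ∀ w : V → ℝ, Measurable w → Periodic2 w → ∀ r, 0 < r → r ≤ r₀ → ∀ x,
      ‖∫ y, w (x + r • y) • rot (m y)‖ₑ
        ≤ C * (ENNReal.ofReal (r ^ 2)⁻¹ ^ (1 / p) * eLpNorm w (ENNReal.ofReal p) μT) := by
  have hp0 : 0 < p := by linarith
  obtain ⟨R, hR⟩ := hs.isCompact.isBounded.subset_closedBall 0
  have hsr : HasCompactSupport fun y => rot (m y) := hs.comp_left (g := rot) (by simp [rot])
  obtain ⟨A, hA⟩ := hsr.exists_bound_of_continuous (continuous_rot.comp hm)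
  set B : Set V := Metric.closedBall 0 R
  have hBf : volume B ≠ ⊤ := measure_closedBall_lt_top.ne
  obtain ⟨N, hN⟩ := setLIntegral_comp_add_smul_le (R := R) (r₀ := r₀)
  have hfin : ENNReal.ofReal A * ((N : ℝ≥0∞) ^ (1 / p) * volume B ^ (1 - 1 / p)) ≠ ⊤ := by
    refine ENNReal.mul_ne_top ENNReal.ofReal_ne_top (ENNReal.mul_ne_top ?_ ?_)
    · exact ENNReal.rpow_ne_top_of_nonneg (by positivity) (ENNReal.natCast_ne_top N)
    · refine ENNReal.rpow_ne_top_of_nonneg ?_ hBf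
      rw [sub_nonneg, div_le_one hp0]; exact hp
  lift ENNReal.ofReal A * ((N : ℝ≥0∞) ^ (1 / p) * volume B ^ (1 - 1 / p)) to ℝ≥0 using hfin
    with C hC
  refine ⟨C, fun w hw hper r hr hr₀ x => ?_⟩
  have hwm : Measurable fun y : V => w (x + r • y) := hw.comp (by fun_prop)
  have hpne : ENNReal.ofReal p ≠ 0 := by simpa using hp0
  have hLp : ∀ (f : V → ℝ) (μ : Measure V), eLpNorm f (ENNReal.ofReal p) μ
      = (∫⁻ y, ‖f y‖ₑ ^ p ∂μ) ^ (1 / p) := fun f μ => by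
    rw [eLpNorm_eq_lintegral_rpow_enorm_toReal hpne ENNReal.ofReal_ne_top,
      ENNReal.toReal_ofReal hp0.le]
  have h1 : ∫⁻ y in B, ‖w (x + r • y)‖ₑ
      ≤ eLpNorm (fun y => w (x + r • y)) (ENNReal.ofReal p) (volume.restrict B)
        * volume B ^ (1 - 1 / p) := by
    rw [← eLpNorm_one_eq_lintegral_enorm]
    have := eLpNorm_le_eLpNorm_mul_rpow_measure_univ (p := 1) (q := ENNReal.ofReal p)
      (by simpa using hp) (hwm.aestronglyMeasurable (μ := volume.restrict B))
    rwa [ENNReal.toReal_ofReal hp0.le, ENNReal.toReal_one, div_one, Measure.restrict_apply_univ]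
      at this
  have h2 : eLpNorm (fun y => w (x + r • y)) (ENNReal.ofReal p) (volume.restrict B)
      ≤ ENNReal.ofReal (r ^ 2)⁻¹ ^ (1 / p) * ((N : ℝ≥0∞) ^ (1 / p)
        * eLpNorm w (ENNReal.ofReal p) μT) := by
    rw [hLp, hLp, ← ENNReal.mul_rpow_of_nonneg _ _ (by positivity),
      ← ENNReal.mul_rpow_of_nonneg _ _ (by positivity)]
    refine ENNReal.rpow_le_rpow ?_ (by positivity)
    exact hN (fun y => ‖w y‖ₑ ^ p) (hw.enorm.pow_const p) (hper.map fun a => ‖a‖ₑ ^ p) r hr hr₀ x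
  calc ‖∫ y, w (x + r • y) • rot (m y)‖ₑ ≤ ∫⁻ y, ‖w (x + r • y) • rot (m y)‖ₑ :=
        enorm_integral_le_lintegral_enorm _
    _ ≤ ∫⁻ y, B.indicator (fun y => ENNReal.ofReal A * ‖w (x + r • y)‖ₑ) y := by
        refine lintegral_mono fun y => ?_
        by_cases hy : y ∈ B
        · rw [Set.indicator_of_mem hy, enorm_smul, mul_comm]
          gcongr
          rw [← ofReal_norm]
          exact ENNReal.ofReal_le_ofReal (hA y)
        · have : m y = 0 := by
            by_contra h
            exact hy (hR (subset_tsupport m h))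
          simp [this, rot, ← Prod.zero_eq_mk]
    _ = ENNReal.ofReal A * ∫⁻ y in B, ‖w (x + r • y)‖ₑ := by
        rw [lintegral_indicator measurableSet_closedBall, lintegral_const_mul _ hwm.enorm]
    _ ≤ ENNReal.ofReal A * (ENNReal.ofReal (r ^ 2)⁻¹ ^ (1 / p) * ((N : ℝ≥0∞) ^ (1 / p)
        * eLpNorm w (ENNReal.ofReal p) μT) * volume B ^ (1 - 1 / p)) := by
        gcongr
        exact h1.trans (by gcongr)
    _ = _ := by rw [hC]; ring

end DyadicBounds

section VelocityBound

variable {ρ : V → ℝ} {m : V → V} {w : V → ℝ} {u : V → V}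

theorem tendsto_scaleAvg (hρ : Continuous ρ) (hρs : HasCompactSupport ρ) (hu : Continuous u)
    (hp : Periodic2 u) (x : V) {ι : Type*} {l : Filter ι} [l.IsCountablyGenerated]
    {r : ι → ℝ} (hr : Tendsto r l (𝓝 0)) :
    Tendsto (fun n => scaleAvg ρ u (r n) x) l (𝓝 ((∫ y, ρ y) • u x)) := by
  obtain ⟨U, hU⟩ := hp.exists_bound hu
  rw [← integral_smul_const]
  refine tendsto_integral_filter_of_dominated_convergence (fun y => ‖ρ y‖ * U)
    (Eventually.of_forall fun n => (hρ.smul (hu.comp (by fun_prop))).aestronglyMeasurable)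
    (Eventually.of_forall fun n => Eventually.of_forall fun y => ?_)
    ((hρ.integrable_of_hasCompactSupport hρs).norm.mul_const U) (Eventually.of_forall fun y => ?_)
  · rw [norm_smul]
    gcongr
    exact hU _
  · refine Tendsto.const_smul ?_ _
    have h : Tendsto (fun n => x + r n • y) l (𝓝 (x + (0 : ℝ) • y)) :=
      tendsto_const_nhds.add (hr.smul_const y)
    rw [zero_smul, add_zero] at h
    exact (hu.tendsto x).comp h

/-- `L^p` vorticity with `p > 2` controls the velocity uniformly. -/
theorem exists_velocity_bound {p : ℝ} (hp : 2 < p) : ∃ C : ℝ, 0 ≤ C ∧ ∀ (w : V → ℝ) (u : V → V),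
    IsSlice w u → eLpNorm w (ENNReal.ofReal p) μT ≠ ⊤ →
      ∀ x, ‖u x‖ ≤ C * (eLpNorm w (ENNReal.ofReal p) μT).toReal := by
  obtain ⟨ρ, m, hρ, hρs, hρ0, hm, hms, hc, hd⟩ := exists_dyadic_kernel
  obtain ⟨L, hL0, hL⟩ := exists_norm_scaleAvg_le hρ hρs
  set c := ∫ x, ρ x
  set r₀ : ℝ := max 1 (2 * L / c)
  have hr₀ : 1 ≤ r₀ := le_max_left _ _
  have hr₀' : 0 < r₀ := by linarith
  have hLr : L / r₀ ≤ c / 2 := by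
    have : 2 * L / c ≤ r₀ := le_max_right _ _
    rw [div_le_iff₀ hρ0] at this
    rw [div_le_iff₀ hr₀']
    linarith
  obtain ⟨C, hC⟩ := exists_enorm_dyadic_le hm.continuous hms (by linarith : 1 ≤ p) r₀
  set α : ℝ := 1 - 2 / p
  have hα : 0 < α := by
    have : 2 / p < 1 := by rw [div_lt_one (by linarith)]; exact hp
    simp only [α]; linarith
  set q : ℝ := (1 / 2 : ℝ) ^ α
  have hq1 : q < 1 := Real.rpow_lt_one (by norm_num) (by norm_num) hα
  have hq0 : 0 < q := by positivity
  set D : ℝ := C * r₀ ^ α * q / (1 - q)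
  have hD : 0 ≤ D := by
    have : 0 < 1 - q := by linarith
    positivity
  refine ⟨2 * D / c, by positivity, fun w u h hw x => ?_⟩
  set W := (eLpNorm w (ENNReal.ofReal p) μT).toReal
  have hu := h.continuous
  have hup := h.biotSavart.periodic
  have hnear : ∀ r, 0 < r → r ≤ r₀ → ∀ x,
      ‖scaleAvg ρ u r x - scaleAvg ρ u (2 * r) x‖ ≤ C * W * r ^ α := by
    intro r hr hrr x
    rw [scaleAvg_sub hρ.continuous hρs hm hms hc hd h hr, norm_smul, Real.norm_of_nonneg hr.le]
    have h1 := hC w h.measurable h.periodic r hr hrr x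
    have hfin : (C : ℝ≥0∞) * (ENNReal.ofReal (r ^ 2)⁻¹ ^ (1 / p)
        * eLpNorm w (ENNReal.ofReal p) μT) ≠ ⊤ :=
      ENNReal.mul_ne_top ENNReal.coe_ne_top (ENNReal.mul_ne_top
        (ENNReal.rpow_ne_top_of_nonneg (by positivity) ENNReal.ofReal_ne_top) hw)
    have h2 := ENNReal.toReal_mono hfin h1
    rw [toReal_enorm, ENNReal.toReal_mul, ENNReal.toReal_mul, ← ENNReal.toReal_rpow,
      ENNReal.toReal_ofReal (by positivity), ENNReal.coe_toReal] at h2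
    calc r * ‖∫ y, w (x + r • y) • rot (m y)‖ ≤ r * (C * (((r ^ 2)⁻¹) ^ (1 / p) * W)) := by gcongr
      _ = C * W * (r * ((r ^ 2)⁻¹) ^ (1 / p)) := by ring
      _ = C * W * r ^ α := by
        congr 1
        rw [← Real.rpow_natCast r 2, ← Real.rpow_neg hr.le, ← Real.rpow_mul hr.le]
        nth_rewrite 1 [← Real.rpow_one r]
        rw [← Real.rpow_add hr]
        congr 1
        simp only [α]
        push_cast
        ring
  have hlim : ∀ x, ‖c • u x‖ ≤ D * W + ‖scaleAvg ρ u r₀ x‖ := by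
    intro x
    have ht : Tendsto (fun n : ℕ => r₀ * (1 / 2 : ℝ) ^ n) atTop (𝓝 0) := by
      simpa using (tendsto_pow_atTop_nhds_zero_of_lt_one (r := (1 / 2 : ℝ))
        (by norm_num) (by norm_num)).const_mul r₀
    have hf := tendsto_scaleAvg hρ.continuous hρs hu hup x ht
    have hgeo := dist_le_of_le_geometric_of_tendsto₀ q (C * W * r₀ ^ α * q) hq1 (fun n => by
      have hpos : (0 : ℝ) < r₀ * (1 / 2) ^ (n + 1) := by positivity
      have hle : r₀ * (1 / 2 : ℝ) ^ (n + 1) ≤ r₀ :=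
        mul_le_of_le_one_right hr₀'.le (pow_le_one₀ (by norm_num) (by norm_num))
      have := hnear _ hpos hle x
      rw [show 2 * (r₀ * (1 / 2 : ℝ) ^ (n + 1)) = r₀ * (1 / 2) ^ n by ring, norm_sub_rev,
        ← dist_eq_norm, Real.mul_rpow hr₀'.le (by positivity),
        ← Real.rpow_pow_comm (by norm_num)] at this
      refine this.trans (le_of_eq ?_)
      rw [pow_succ]
      ring) hf
    rw [pow_zero, mul_one, dist_eq_norm, norm_sub_rev] at hgeo
    calc ‖c • u x‖ ≤ ‖c • u x - scaleAvg ρ u r₀ x‖ + ‖scaleAvg ρ u r₀ x‖ := norm_le_norm_sub_add _ _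
      _ ≤ _ := by
        gcongr
        refine hgeo.trans (le_of_eq ?_)
        simp only [D]
        ring
  obtain ⟨U₀, hU₀⟩ := hup.exists_bound hu
  set U := ⨆ x, ‖u x‖
  have hbdd : BddAbove (Set.range fun x => ‖u x‖) := ⟨U₀, by rintro _ ⟨x, rfl⟩; exact hU₀ x⟩
  have hU : ∀ x, ‖u x‖ ≤ U := fun x => le_ciSup hbdd x
  have hU0 : 0 ≤ U := (norm_nonneg _).trans (hU 0)
  have hmain : ∀ x, ‖u x‖ ≤ (D * W + c / 2 * U) / c := by
    intro x
    rw [le_div_iff₀ hρ0, mul_comm]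
    have h1 := hlim x
    rw [norm_smul, Real.norm_of_nonneg hρ0.le] at h1
    have h2 := hL u hu hup h.biotSavart.mean_zero U hU r₀ hr₀ x
    have h3 : L / r₀ * U ≤ c / 2 * U := by gcongr
    linarith
  have hUle : U ≤ (D * W + c / 2 * U) / c := ciSup_le hmain
  rw [le_div_iff₀ hρ0] at hUle
  refine (hU x).trans ?_
  rw [div_mul_eq_mul_div, le_div_iff₀ hρ0]
  linarith

theorem tendsto_dyadic_sum (hρ : ContDiff ℝ 1 ρ) (hρs : HasCompactSupport ρ)
    (hm : ContDiff ℝ 1 m) (hs : HasCompactSupport m)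
    (hc : ∀ x, curl2 m x = 0) (hd : ∀ x, div2 m x = ρ x - 1 / 4 * ρ ((1 / 2 : ℝ) • x))
    (h : IsSlice w u) (x : V) :
    Tendsto (fun n : ℕ => ∑ j ∈ Finset.range (2 * n), ((1 / 2 : ℝ) ^ n * 2 ^ j) •
      ∫ y, w (x + ((1 / 2 : ℝ) ^ n * 2 ^ j) • y) • rot (m y)) atTop (𝓝 ((∫ y, ρ y) • u x)) := by
  obtain ⟨L, hL0, hL⟩ := exists_norm_scaleAvg_le hρ hρs
  obtain ⟨U, hU⟩ := h.biotSavart.periodic.exists_bound h.continuous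
  have e : ∀ n : ℕ, ∑ j ∈ Finset.range (2 * n), ((1 / 2 : ℝ) ^ n * 2 ^ j) •
      ∫ y, w (x + ((1 / 2 : ℝ) ^ n * 2 ^ j) • y) • rot (m y)
      = scaleAvg ρ u ((1 / 2 : ℝ) ^ n) x - scaleAvg ρ u (2 ^ n) x := by
    intro n
    have h1 : ∀ j : ℕ, ((1 / 2 : ℝ) ^ n * 2 ^ j) •
        ∫ y, w (x + ((1 / 2 : ℝ) ^ n * 2 ^ j) • y) • rot (m y)
        = scaleAvg ρ u ((1 / 2 : ℝ) ^ n * 2 ^ j) x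
          - scaleAvg ρ u ((1 / 2 : ℝ) ^ n * 2 ^ (j + 1)) x := by
      intro j
      rw [← scaleAvg_sub hρ.continuous hρs hm hs hc hd h (by positivity)]
      congr 2
      ring
    rw [Finset.sum_congr rfl fun j _ => h1 j,
      Finset.sum_range_sub' fun j => scaleAvg ρ u ((1 / 2 : ℝ) ^ n * 2 ^ j) x]
    have h2 : (1 / 2 : ℝ) ^ n * 2 ^ (2 * n) = 2 ^ n := by
      rw [two_mul, pow_add, ← mul_assoc, ← mul_pow]
      norm_num
    simp only [pow_zero, mul_one, h2]
  simp only [e]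
  rw [← sub_zero ((∫ y, ρ y) • u x)]
  refine (tendsto_scaleAvg hρ.continuous hρs h.continuous h.biotSavart.periodic x
    (tendsto_pow_atTop_nhds_zero_of_lt_one (by norm_num) (by norm_num))).sub ?_
  have ht : Tendsto (fun n : ℕ => L / (2 : ℝ) ^ n * U) atTop (𝓝 0) := by
    have := ((tendsto_pow_atTop_nhds_zero_of_lt_one (r := (1 / 2 : ℝ))
        (by norm_num) (by norm_num)).const_mul L).mul_const U
    rw [mul_zero, zero_mul] at this
    refine this.congr fun n => ?_
    rw [one_div_pow, mul_one_div]
  exact squeeze_zero_norm (fun n => hL u h.continuous h.biotSavart.periodic h.biotSavart.mean_zero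
    U hU _ (one_le_pow₀ one_le_two) x) ht

/-- The Biot–Savart velocity depends measurably on time. -/
theorem measurable_velocity {ω : ℝ → V → ℝ} {u : ℝ → V → V} {I : Set ℝ} (hI : MeasurableSet I)
    (hω : Measurable (Function.uncurry ω)) (h : ∀ t ∈ I, IsSlice (ω t) (u t)) :
    Measurable fun q : ℝ × V => I.indicator (fun t => u t q.2) q.1 := by
  obtain ⟨ρ, m, hρ, hρs, hρ0, hm, hms, hc, hd⟩ := exists_dyadic_kernel
  let g : ℕ → ℝ × V → V := fun n q => I.indicator (fun t => (∫ y, ρ y)⁻¹ •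
    ∑ j ∈ Finset.range (2 * n), ((1 / 2 : ℝ) ^ n * 2 ^ j) •
      ∫ y, ω t (q.2 + ((1 / 2 : ℝ) ^ n * 2 ^ j) • y) • rot (m y)) q.1
  refine measurable_of_tendsto_metrizable (f := g) (fun n => ?_) ?_
  · have hterm : ∀ r : ℝ, Measurable fun q : ℝ × V => ∫ y, ω q.1 (q.2 + r • y) • rot (m y) := by
      intro r
      have hj : Measurable fun z : (ℝ × V) × V => ω z.1.1 (z.1.2 + r • z.2) • rot (m z.2) := by
        have h1 : Measurable fun z : (ℝ × V) × V => ω z.1.1 (z.1.2 + r • z.2) :=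
          hω.comp (by fun_prop : Measurable fun z : (ℝ × V) × V => (z.1.1, z.1.2 + r • z.2))
        have h2 : Measurable fun z : (ℝ × V) × V => rot (m z.2) :=
          (continuous_rot.comp hm.continuous).measurable.comp measurable_snd
        exact h1.smul h2
      exact hj.stronglyMeasurable.integral_prod_right'.measurable
    have hsum : Measurable fun q : ℝ × V => (∫ y, ρ y)⁻¹ • ∑ j ∈ Finset.range (2 * n),
        ((1 / 2 : ℝ) ^ n * 2 ^ j) • ∫ y, ω q.1 (q.2 + ((1 / 2 : ℝ) ^ n * 2 ^ j) • y) • rot (m y) :=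
      (Finset.measurable_fun_sum _ fun j _ => (hterm _).fun_const_smul _).fun_const_smul _
    exact hsum.indicator (measurable_fst hI)
  · rw [tendsto_pi_nhds]
    rintro ⟨t, x⟩
    by_cases ht : t ∈ I
    · simp only [g, Set.indicator_of_mem ht]
      have := (tendsto_dyadic_sum hρ hρs hm hms hc hd (h t ht) x).const_smul (∫ y, ρ y)⁻¹
      rwa [smul_smul, inv_mul_cancel₀ hρ0.ne', one_smul] at this
    · simp only [g, Set.indicator_of_notMem ht]
      exact tendsto_const_nhds

end VelocityBound

section SpaceTime

/-- The strip `ℝ × 𝕋²` inside `ℝ × ℝ²`. -/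
def strip : Set (ℝ × V) := Set.univ ×ˢ Fund

theorem measurableSet_strip : MeasurableSet strip := MeasurableSet.univ.prod measurableSet_Fund

instance : (volume : Measure (ℝ × V)).IsAddHaarMeasure := by
  rw [Measure.volume_eq_prod]
  infer_instance

/-- Coordinate directions of `ℝ × ℝ²`, time first. -/
def stDir : Fin 3 → ℝ × V := ![(1, 0), (0, (1, 0)), (0, (0, 1))]

/-- A periodic space-time field that is integrable and square integrable on the strip. -/
structure IsStField (f : ℝ × V → ℝ) : Prop where
  periodic : ∀ t, Periodic2 fun x => f (t, x)
  measurable : Measurable f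
  integrable : IntegrableOn f strip
  integrable_sq : IntegrableOn (fun q => f q ^ 2) strip

theorem IsStField.bdd_mul {f b : ℝ × V → ℝ} (hf : IsStField f) (hb : Measurable b)
    (hbp : ∀ t, Periodic2 fun x => b (t, x)) {C : ℝ} (hC : ∀ q, ‖b q‖ ≤ C) :
    IsStField fun q => b q * f q where
  periodic t := (hbp t).map₂ (hf.periodic t) fun a b => a * b
  measurable := hb.mul hf.measurable
  integrable := hf.integrable.bdd_mul hb.aestronglyMeasurable (Eventually.of_forall hC)
  integrable_sq := by
    simp only [mul_pow]
    refine hf.integrable_sq.bdd_mul (c := C ^ 2) (hb.pow_const 2).aestronglyMeasurable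
      (Eventually.of_forall fun q => ?_)
    rw [norm_pow]
    exact pow_le_pow_left₀ (norm_nonneg _) (hC q) 2

theorem IsStField.locallyIntegrable {f : ℝ × V → ℝ} (hf : IsStField f) : LocallyIntegrable f :=
  locallyIntegrable_of_strip hf.periodic hf.measurable.stronglyMeasurable hf.integrable

variable {T : ℝ} {ψ : ℝ × V → ℝ}

theorem TestFn.contDiff (hψ : TestFn T fun t x => ψ (t, x)) : ContDiff ℝ (⊤ : ℕ∞) ψ := hψ.smooth

theorem exists_bound_of_support {h : ℝ × V → ℝ} (hc : Continuous h)
    (hp : ∀ t, Periodic2 fun x => h (t, x)) {a b : ℝ} (hs : ∀ t ∉ Set.Icc a b, ∀ x, h (t, x) = 0) :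
    ∃ C, 0 ≤ C ∧ ∀ q, ‖h q‖ ≤ C := by
  obtain ⟨C, hC⟩ := ((isCompact_Icc (a := a) (b := b)).prod
    (isCompact_Icc (a := (0 : V)) (b := 1))).exists_bound_of_continuousOn hc.continuousOn
  refine ⟨max C 0, le_max_right _ _, fun ⟨t, x⟩ => ?_⟩
  by_cases ht : t ∈ Set.Icc a b
  · obtain ⟨y, hy, hxy⟩ := (hp t).exists_mem_Fund x
    rw [hxy]
    exact (hC (t, y) ⟨ht, Fund_subset_Icc hy⟩).trans (le_max_left _ _)
  · rw [hs t ht, norm_zero]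
    exact le_max_right _ _

theorem fderiv_periodic (hp : ∀ t, Periodic2 fun x => ψ (t, x))
    (v : ℝ × V) (t : ℝ) : Periodic2 fun x => fderiv ℝ ψ (t, x) v := by
  have key : ∀ c : V, (∀ t x, ψ (t, x + c) = ψ (t, x)) → ∀ x,
      fderiv ℝ ψ (t, x + c) v = fderiv ℝ ψ (t, x) v := by
    intro c hc x
    have h : (fun q => ψ (q + (0, c))) = ψ := funext fun ⟨t, x⟩ => by simpa using hc t x
    have h2 := fderiv_comp_add_right (𝕜 := ℝ) (f := ψ) (x := (t, x)) ((0 : ℝ), c)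
    rw [h] at h2
    rw [h2]
    simp
  exact fun x => ⟨key _ (fun t x => (hp t x).1) x, key _ (fun t x => (hp t x).2) x⟩

theorem fderiv_eq_zero_of_support {a b : ℝ} (hs : ∀ t ∉ Set.Icc a b, ∀ x, ψ (t, x) = 0)
    (v : ℝ × V) (t : ℝ) (ht : t ∉ Set.Icc a b) (x : V) : fderiv ℝ ψ (t, x) v = 0 := by
  have h : ψ =ᶠ[𝓝 (t, x)] fun _ => 0 := by
    filter_upwards [(isClosed_Icc.isOpen_compl.preimage continuous_fst).mem_nhds ht] with q hq
    exact hs q.1 hq q.2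
  rw [h.fderiv_eq]
  simp

theorem integral_fderiv_conv_comm {Θ f g : ℝ × V → ℝ} (hΘ : ContDiff ℝ (⊤ : ℕ∞) Θ)
    (hΘs : HasCompactSupport Θ) (hΘe : ∀ z, Θ (-z) = Θ z) (hf : IsStField f) (hg : IsStField g)
    (v : ℝ × V) :
    ∫ z in strip, g z * ∫ w, fderiv ℝ Θ w v * f (z - w)
      = -∫ z in strip, f z * ∫ w, fderiv ℝ Θ w v * g (z - w) := by
  have hodd := fderiv_neg_of_even (hΘ.differentiable (by simp)) hΘe
  have hi : Integrable fun w => fderiv ℝ Θ w v :=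
    ((hΘ.continuous_fderiv (by simp)).clm_apply continuous_const).integrable_of_hasCompactSupport
      (hΘs.fderiv_apply (𝕜 := ℝ) v)
  rw [strip, setIntegral_mul_kernel_comm isAddFundamentalDomain_strip
    (vadd_of_periodic2 hf.periodic) (vadd_of_periodic2 hg.periodic) hf.measurable hg.measurable
    hf.integrable_sq hg.integrable_sq hi, ← integral_neg]
  refine integral_congr_ae (Eventually.of_forall fun z => ?_)
  simp only [hodd, neg_mul, integral_neg, mul_neg]

theorem IsStField.integrable_mul_kernel {k f g : ℝ × V → ℝ} (hf : IsStField f) (hg : IsStField g)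
    (hk : Integrable k) : IntegrableOn (fun z => g z * ∫ w, k w * f (z - w)) strip :=
  _root_.integrable_mul_kernel isAddFundamentalDomain_strip (vadd_of_periodic2 hf.periodic)
    hf.measurable hg.measurable hf.integrable_sq hg.integrable_sq hk

/-- The symmetrized weak formulation tested against a space-time mollification. -/
theorem weak_commutator {F : Fin 3 → ℝ × V → ℝ} (hF : ∀ j, IsStField (F j))
    (hweak : ∀ Ψ : ℝ × V → ℝ, TestFn T (fun t x => Ψ (t, x)) →
      ∫ z in strip, ∑ j, F j z * fderiv ℝ Ψ z (stDir j) = 0)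
    {Θ : ℝ × V → ℝ} (hΘ : ContDiff ℝ (⊤ : ℕ∞) Θ) (hΘs : HasCompactSupport Θ)
    (hΘe : ∀ z, Θ (-z) = Θ z) {δ : ℝ} (hδ : ∀ s y, δ < |s| → Θ (s, y) = 0)
    {a b : ℝ} (ha : 0 < a - δ) (hb : b + δ < T) (hψ : ContDiff ℝ (⊤ : ℕ∞) ψ)
    (hψp : ∀ t, Periodic2 fun x => ψ (t, x)) (hs : ∀ t ∉ Set.Icc a b, ∀ x, ψ (t, x) = 0)
    (hδ0 : 0 ≤ δ) :
    ∑ j, (∫ z in strip, (fderiv ℝ ψ z (stDir j) * F j z) * ∫ w, Θ w * F 0 (z - w))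
      + ∑ j, ((∫ z in strip, (ψ z * F j z) * ∫ w, fderiv ℝ Θ w (stDir j) * F 0 (z - w))
        - ∫ z in strip, (ψ z * F 0 z) * ∫ w, fderiv ℝ Θ w (stDir j) * F j (z - w)) = 0 := by
  have hΘ1 : ContDiff ℝ 1 Θ := hΘ.of_le (by simp)
  have hψd : Differentiable ℝ ψ := hψ.differentiable (by simp)
  obtain ⟨C, -, hC⟩ := exists_bound_of_support hψ.continuous hψp hs
  have hψF : ∀ j, IsStField fun z => ψ z * F j z := fun j =>
    (hF j).bdd_mul hψ.continuous.measurable hψp hC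
  have hψ'F : ∀ j, IsStField fun z => fderiv ℝ ψ z (stDir j) * F j z := fun j => by
    have hc : Continuous fun z => fderiv ℝ ψ z (stDir j) :=
      (hψ.continuous_fderiv (by simp)).clm_apply continuous_const
    have hp := fderiv_periodic hψp (stDir j)
    obtain ⟨C, -, hC⟩ := exists_bound_of_support hc hp (fderiv_eq_zero_of_support hs _)
    exact (hF j).bdd_mul hc.measurable hp hC
  have hΘi : Integrable Θ := hΘ.continuous.integrable_of_hasCompactSupport hΘs
  have hΘ'i : ∀ v, Integrable fun w => fderiv ℝ Θ w v := fun v =>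
    ((hΘ.continuous_fderiv (by simp)).clm_apply continuous_const).integrable_of_hasCompactSupport
      (hΘs.fderiv_apply (𝕜 := ℝ) v)
  let J : (ℝ × V → ℝ) → ℝ × V → ℝ := fun f =>
    convolution Θ f (ContinuousLinearMap.lsmul ℝ ℝ) volume
  have hJ : ∀ {f}, IsStField f → ContDiff ℝ (⊤ : ℕ∞) (J f) := fun hf =>
    hΘs.contDiff_convolution_left _ hΘ hf.locallyIntegrable
  have hJp : ∀ {f}, IsStField f → ∀ t, Periodic2 fun x => J f (t, x) := by
    intro f hf t x
    have e : ∀ (y : V) (w : ℝ × V), ((t, x + y) - w : ℝ × V) = (t - w.1, x - w.2 + y) :=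
      fun y w => Prod.ext rfl (add_sub_right_comm x y w.2)
    simp only [J, convolution_def, e]
    exact ⟨integral_congr_ae (Eventually.of_forall fun w => by
        simp only [(hf.periodic _ _).1, Prod.sub_def]),
      integral_congr_ae (Eventually.of_forall fun w => by
        simp only [(hf.periodic _ _).2, Prod.sub_def])⟩
  have hJ' : ∀ {f}, IsStField f → ∀ z v, fderiv ℝ (J f) z v = ∫ w, fderiv ℝ Θ w v * f (z - w) :=
    fun hf z v => fderiv_convolution_apply hΘ1 hΘs hf.locallyIntegrable z v
  have t1 : TestFn T fun t x => J (fun z => ψ z * F 0 z) (t, x) := by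
    refine ⟨hJ (hψF 0), hJp (hψF 0), a - δ, b + δ, ha, hb, fun t ht => funext fun x => ?_⟩
    simp only [J, convolution_def, Pi.zero_apply]
    refine integral_eq_zero_of_ae (Eventually.of_forall fun w => ?_)
    simp only [ContinuousLinearMap.lsmul_apply, smul_eq_mul, Pi.zero_apply]
    by_cases hw : δ < |w.1|
    · rw [hδ w.1 w.2 hw, zero_mul]
    · rw [show ψ ((t, x) - w) = 0 from hs _ ?_ _, zero_mul, mul_zero]
      rw [not_lt, abs_le] at hw
      rw [Set.mem_Icc] at ht ⊢
      intro h
      exact ht ⟨by simp at h; linarith, by simp at h; linarith⟩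
  have t2 : TestFn T fun t x => ψ (t, x) * J (F 0) (t, x) := by
    refine ⟨hψ.mul (hJ (hF 0)), fun t => (hψp t).map₂ (hJp (hF 0) t) fun a b => a * b, a, b,
      by linarith, by linarith, fun t ht => funext fun x => ?_⟩
    simp [hs t ht]
  have w1 := hweak _ t1
  have w2 := hweak (fun z => ψ z * J (F 0) z) t2
  simp only [hJ' (hψF 0)] at w1
  have e2 : ∀ z j, F j z * fderiv ℝ (fun z => ψ z * J (F 0) z) z (stDir j)
      = (fderiv ℝ ψ z (stDir j) * F j z) * (∫ w, Θ w * F 0 (z - w))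
        + (ψ z * F j z) * ∫ w, fderiv ℝ Θ w (stDir j) * F 0 (z - w) := by
    intro z j
    rw [fderiv_fun_mul (hψd z) ((hJ (hF 0)).differentiable (by simp) z), ← hJ' (hF 0)]
    simp only [add_apply, smul_apply, smul_eq_mul, J,
      convolution_def, ContinuousLinearMap.lsmul_apply]
    ring
  simp only [e2] at w2
  rw [integral_finsetSum _ fun j _ => (hψF 0).integrable_mul_kernel (hF j) (hΘ'i _)] at w1
  rw [integral_finsetSum _ fun j _ => (((hF 0).integrable_mul_kernel (hψ'F j) hΘi).fun_add
    ((hF 0).integrable_mul_kernel (hψF j) (hΘ'i _)) :), Finset.sum_congr rfl fun j _ => integral_add ((hF 0).integrable_mul_kernel (hψ'F j) hΘi)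
    ((hF 0).integrable_mul_kernel (hψF j) (hΘ'i (stDir j))), Finset.sum_add_distrib] at w2
  rw [Finset.sum_congr rfl fun j _ => integral_fderiv_conv_comm hΘ hΘs hΘe (hψF 0) (hF j)
    (stDir j), Finset.sum_neg_distrib] at w1
  rw [Finset.sum_sub_distrib]
  linarith

end SpaceTime

section TimeMollification

/-- Convolution in the space variable only. -/
def spaceConv (K : V → ℝ) (f : ℝ × V → ℝ) (q : ℝ × V) : ℝ := ∫ y, K y * f (q.1, q.2 - y)

theorem strip_measure : (volume : Measure (ℝ × V)).restrict strip
    = (volume : Measure ℝ).prod (volume.restrict Fund) := by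
  rw [strip, Measure.volume_eq_prod, ← Measure.prod_restrict, Measure.restrict_univ]

theorem measurable_spaceConv {K : V → ℝ} {f : ℝ × V → ℝ} (hK : Continuous K) (hf : Measurable f) :
    Measurable (spaceConv K f) := by
  have h1 : Measurable fun z : (ℝ × V) × V => K z.2 := hK.measurable.comp measurable_snd
  have h2 : Measurable fun z : (ℝ × V) × V => f (z.1.1, z.1.2 - z.2) :=
    hf.comp (by fun_prop : Measurable fun z : (ℝ × V) × V => (z.1.1, z.1.2 - z.2))
  exact (h1.mul h2).stronglyMeasurable.integral_prod_right'.measurable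

theorem exists_bound_spaceConv {K : V → ℝ} {f : ℝ × V → ℝ} (hK : Continuous K)
    (hKs : HasCompactSupport K) (hp : ∀ t, Periodic2 fun x => f (t, x))
    (hb : ∃ M : ℝ≥0, ∀ t, ∫⁻ x in Fund, ‖f (t, x)‖ₑ ≤ M) :
    ∃ C : ℝ, ∀ q, ‖spaceConv K f q‖ ≤ C := by
  obtain ⟨M, hM⟩ := hb
  obtain ⟨A, hA⟩ := hKs.exists_bound_of_continuous hK
  obtain ⟨N, hN⟩ := exists_setLIntegral_le (K := -tsupport K) hKs.isCompact.neg.isBounded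
  refine ⟨(A.toNNReal * (N * M) : ℝ≥0), fun q => ?_⟩
  rw [← coe_nnnorm, NNReal.coe_le_coe, ← ENNReal.coe_le_coe, ← enorm_eq_nnnorm, spaceConv]
  have hpt : ∀ y, ‖K y * f (q.1, q.2 - y)‖ₑ
      ≤ (-tsupport K).indicator (fun y => A.toNNReal * ‖f (q.1, q.2 + y)‖ₑ) (-y) := by
    intro y
    by_cases hy : y ∈ tsupport K
    · rw [Set.indicator_of_mem (by simpa using hy), enorm_mul, ← sub_eq_add_neg]
      gcongr
      rw [enorm_le_coe, ← NNReal.coe_le_coe, coe_nnnorm]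
      exact (hA y).trans (Real.le_coe_toNNReal _)
    · rw [image_eq_zero_of_notMem_tsupport hy]
      simp
  calc ‖∫ y, K y * f (q.1, q.2 - y)‖ₑ ≤ ∫⁻ y, ‖K y * f (q.1, q.2 - y)‖ₑ :=
        enorm_integral_le_lintegral_enorm _
    _ ≤ ∫⁻ y, (-tsupport K).indicator (fun y => A.toNNReal * ‖f (q.1, q.2 + y)‖ₑ) (-y) :=
        lintegral_mono hpt
    _ = ∫⁻ y, (-tsupport K).indicator (fun y => A.toNNReal * ‖f (q.1, q.2 + y)‖ₑ) y :=
        lintegral_neg_eq_self _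
    _ = A.toNNReal * ∫⁻ y in -tsupport K, ‖f (q.1, q.2 + y)‖ₑ := by
        rw [lintegral_indicator hKs.isCompact.neg.measurableSet,
          lintegral_const_mul' _ _ ENNReal.coe_ne_top]
    _ ≤ A.toNNReal * (N * M) := by
        gcongr
        refine (hN (fun x => ‖f (q.1, x)‖ₑ) ((hp q.1).map _) q.2).trans ?_
        gcongr
        exact hM _
    _ = _ := by push_cast; rfl

theorem ae_tendsto_timeMollify {B : ℝ × V → ℝ} (hB : Measurable B) {C : ℝ} (hC : ∀ q, ‖B q‖ ≤ C)
    {ρ : ℕ → ContDiffBump (0 : ℝ)} (hρ : Tendsto (fun n => (ρ n).rOut) atTop (𝓝 0)) {A : ℝ}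
    (hA : ∀ n, (ρ n).rOut ≤ A * (ρ n).rIn) :
    ∀ᵐ q ∂(volume : Measure (ℝ × V)).restrict strip,
      Tendsto (fun n => ∫ s, (ρ n).normed volume s * B (q.1 - s, q.2)) atTop (𝓝 (B q)) := by
  have hm : ∀ n, Measurable fun q : ℝ × V => ∫ s, (ρ n).normed volume s * B (q.1 - s, q.2) := by
    intro n
    have h1 : Measurable fun z : (ℝ × V) × ℝ => (ρ n).normed volume z.2 :=
      (ρ n).continuous_normed.measurable.comp measurable_snd
    have h2 : Measurable fun z : (ℝ × V) × ℝ => B (z.1.1 - z.2, z.1.2) :=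
      hB.comp (by fun_prop : Measurable fun z : (ℝ × V) × ℝ => (z.1.1 - z.2, z.1.2))
    exact (h1.mul h2).stronglyMeasurable.integral_prod_right'.measurable
  have hset : MeasurableSet {q : ℝ × V | Tendsto
      (fun n => ∫ s, (ρ n).normed volume s * B (q.1 - s, q.2)) atTop (𝓝 (B q))} :=
    measurableSet_tendsto_fun hm hB
  rw [strip_measure]
  refine (Measure.ae_prod_mem_iff_ae_ae_mem hset).2 ?_
  refine (Measure.ae_ae_comm (p := fun t x => (t, x) ∈ {q : ℝ × V | Tendsto
      (fun n => ∫ s, (ρ n).normed volume s * B (q.1 - s, q.2)) atTop (𝓝 (B q))}) hset).2 ?_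
  refine Eventually.of_forall fun x => ?_
  have hBx : LocallyIntegrable fun t => B (t, x) := by
    have h1 : Measurable fun t => B (t, x) := hB.comp (by fun_prop)
    exact (memLp_top_of_bound h1.aestronglyMeasurable C
      (Eventually.of_forall fun t => hC _)).locallyIntegrable le_top
  exact ContDiffBump.ae_convolution_tendsto_right_of_locallyIntegrable hρ
    (Eventually.of_forall hA) hBx

theorem tendsto_timeMollify {K : V → ℝ} {f g : ℝ × V → ℝ} (hK : Continuous K)
    (hKs : HasCompactSupport K) (hf : IsStField f) (hg : IsStField g)
    (hb : ∃ M : ℝ≥0, ∀ t, ∫⁻ x in Fund, ‖f (t, x)‖ₑ ≤ M)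
    {ρ : ℕ → ContDiffBump (0 : ℝ)} (hρ : Tendsto (fun n => (ρ n).rOut) atTop (𝓝 0)) {A : ℝ}
    (hA : ∀ n, (ρ n).rOut ≤ A * (ρ n).rIn) :
    Tendsto (fun n => ∫ z in strip, g z * ∫ w : ℝ × V,
        ((ρ n).normed volume w.1 * K w.2) * f (z - w)) atTop
      (𝓝 (∫ z in strip, g z * spaceConv K f z)) := by
  obtain ⟨C, hC⟩ := exists_bound_spaceConv hK hKs hf.periodic hb
  have hBm := measurable_spaceConv hK hf.measurable
  have e : ∀ n z, ∫ w : ℝ × V, ((ρ n).normed volume w.1 * K w.2) * f (z - w)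
      = ∫ s, (ρ n).normed volume s * spaceConv K f (z.1 - s, z.2) := by
    intro n z
    have hc : Continuous fun w : ℝ × V => (ρ n).normed volume w.1 * K w.2 :=
      ((ρ n).continuous_normed.comp continuous_fst).mul (hK.comp continuous_snd)
    have hcs : HasCompactSupport fun w : ℝ × V => (ρ n).normed volume w.1 * K w.2 := by
      refine HasCompactSupport.intro ((ρ n).hasCompactSupport_normed (μ := volume)
        |>.isCompact.prod hKs.isCompact) fun w hw => ?_
      rw [Set.mem_prod, not_and_or] at hw
      rcases hw with hw | hw
      · rw [image_eq_zero_of_notMem_tsupport hw, zero_mul]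
      · rw [image_eq_zero_of_notMem_tsupport hw, mul_zero]
    have hi : Integrable (fun w : ℝ × V => ((ρ n).normed volume w.1 * K w.2) * f (z - w))
        (volume.prod volume) :=
      (hcs.convolutionExists_left (ContinuousLinearMap.lsmul ℝ ℝ) hc hf.locallyIntegrable z)
    rw [Measure.volume_eq_prod, integral_prod _ hi]
    simp only [spaceConv, ← integral_const_mul, mul_assoc]
    rfl
  simp only [e]
  refine tendsto_integral_of_dominated_convergence (fun z => ‖g z‖ * C) (fun n => ?_)
    (hg.integrable.norm.mul_const C) (fun n => Eventually.of_forall fun z => ?_) ?_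
  · have h1 : Measurable fun z : (ℝ × V) × ℝ => (ρ n).normed volume z.2 :=
      (ρ n).continuous_normed.measurable.comp measurable_snd
    have h2 : Measurable fun z : (ℝ × V) × ℝ => spaceConv K f (z.1.1 - z.2, z.1.2) :=
      hBm.comp (by fun_prop : Measurable fun z : (ℝ × V) × ℝ => (z.1.1 - z.2, z.1.2))
    exact (hg.measurable.mul
      (h1.mul h2).stronglyMeasurable.integral_prod_right'.measurable).aestronglyMeasurable
  · rw [norm_mul]
    gcongr
    calc _ ≤ ∫ s, (ρ n).normed volume s * C := by
          refine norm_integral_le_of_norm_le ((ρ n).integrable_normed.mul_const C)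
            (Eventually.of_forall fun s => ?_)
          rw [norm_mul, Real.norm_of_nonneg ((ρ n).nonneg_normed s)]
          gcongr
          · exact (ρ n).nonneg_normed s
          · exact hC _
      _ = C := by rw [integral_mul_const, (ρ n).integral_normed, one_mul]
  · filter_upwards [ae_tendsto_timeMollify hBm hC hρ hA] with z hz
    exact hz.const_mul _

/-- The symmetrized weak formulation tested against a mollification in space. -/
theorem weak_commutator_space {T : ℝ} {ψ : ℝ × V → ℝ} {k : V → ℝ} {F : Fin 3 → ℝ × V → ℝ}
    (hF : ∀ j, IsStField (F j))
    (hb : ∀ j, ∃ M : ℝ≥0, ∀ t, ∫⁻ x in Fund, ‖F j (t, x)‖ₑ ≤ M)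
    (hweak : ∀ Ψ : ℝ × V → ℝ, TestFn T (fun t x => Ψ (t, x)) →
      ∫ z in strip, ∑ j, F j z * fderiv ℝ Ψ z (stDir j) = 0)
    (hk : IsKernel k) (hψ : TestFn T fun t x => ψ (t, x)) :
    ∑ j, (∫ z in strip, (fderiv ℝ ψ z (stDir j) * F j z) * spaceConv k (F 0) z)
      + ∑ j, ((∫ z in strip, (ψ z * F j z)
          * spaceConv (fun y => fderiv ℝ k y (stDir j).2) (F 0) z)
        - ∫ z in strip, (ψ z * F 0 z)
          * spaceConv (fun y => fderiv ℝ k y (stDir j).2) (F j) z) = 0 := by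
  obtain ⟨a, b, ha, hbT, hs⟩ := hψ.support
  replace hs : ∀ t ∉ Set.Icc a b, ∀ x, ψ (t, x) = 0 := fun t ht x => congrFun (hs t ht) x
  have hψs : ContDiff ℝ (⊤ : ℕ∞) ψ := hψ.smooth
  have hψp : ∀ t, Periodic2 fun x => ψ (t, x) := hψ.periodic
  obtain ⟨C, -, hC⟩ := exists_bound_of_support hψs.continuous hψp hs
  have hψF : ∀ j, IsStField fun z => ψ z * F j z := fun j =>
    (hF j).bdd_mul hψs.continuous.measurable hψp hC
  have hψ'F : ∀ j, IsStField fun z => fderiv ℝ ψ z (stDir j) * F j z := fun j => by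
    have hc : Continuous fun z => fderiv ℝ ψ z (stDir j) :=
      (hψs.continuous_fderiv (by simp)).clm_apply continuous_const
    have hp := fderiv_periodic hψp (stDir j)
    obtain ⟨C, -, hC⟩ := exists_bound_of_support hc hp (fderiv_eq_zero_of_support hs _)
    exact (hF j).bdd_mul hc.measurable hp hC
  let r : ℕ → ℝ := fun n => 1 / ((n : ℝ) + 1)
  have hr0 : ∀ n, 0 < r n := fun n => Nat.one_div_pos_of_nat
  have hr : Tendsto r atTop (𝓝 0) := tendsto_one_div_add_atTop_nhds_zero_nat
  let ρ : ℕ → ContDiffBump (0 : ℝ) := fun n => ⟨r n / 2, r n, half_pos (hr0 n), half_lt_self (hr0 n)⟩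
  have hA : ∀ n, (ρ n).rOut ≤ 2 * (ρ n).rIn := fun n => by simp only [ρ]; linarith
  have hρ0 : ∀ n s, r n < |s| → (ρ n).normed volume s = 0 := by
    intro n s hns
    rw [← Function.notMem_support, (ρ n).support_normed_eq]
    simpa [ρ] using hns.le
  have lim1 := fun j => tendsto_timeMollify hk.contDiff_one.continuous hk.compactSupport (hF 0)
    (hψ'F j) (hb 0) hr (ρ := ρ) hA
  have lim2 := fun j => tendsto_timeMollify (hk.continuous_fderiv_apply (stDir j).2)
    (hk.hasCompactSupport_fderiv_apply (stDir j).2) (hF 0) (hψF j) (hb 0) hr (ρ := ρ) hA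
  have lim3 := fun j => tendsto_timeMollify (hk.continuous_fderiv_apply (stDir j).2)
    (hk.hasCompactSupport_fderiv_apply (stDir j).2) (hF j) (hψF 0) (hb j) hr (ρ := ρ) hA
  have lim := (tendsto_finsetSum Finset.univ fun j _ => lim1 j).add
    (tendsto_finsetSum Finset.univ fun j _ => (lim2 j).sub (lim3 j))
  refine tendsto_nhds_unique lim (tendsto_const_nhds.congr' ?_)
  filter_upwards [hr.eventually_lt_const ha, hr.eventually_lt_const (sub_pos.2 hbT)] with n hn1 hn2
  let Θ : ℝ × V → ℝ := fun w => (ρ n).normed volume w.1 * k w.2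
  have hn : ContDiff ℝ (⊤ : ℕ∞) ((ρ n).normed volume) := (ρ n).contDiff_normed
  have hΘ : ContDiff ℝ (⊤ : ℕ∞) Θ :=
    (hn.comp contDiff_fst).mul (hk.smooth.comp contDiff_snd)
  have hΘs : HasCompactSupport Θ := by
    refine HasCompactSupport.intro ((ρ n).hasCompactSupport_normed (μ := volume)
      |>.isCompact.prod hk.compactSupport.isCompact) fun w hw => ?_
    rw [Set.mem_prod, not_and_or] at hw
    rcases hw with hw | hw
    · simp only [Θ, image_eq_zero_of_notMem_tsupport hw, zero_mul]
    · simp only [Θ, image_eq_zero_of_notMem_tsupport hw, mul_zero]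
  have h := weak_commutator hF hweak hΘ hΘs
    (fun z => by simp only [Θ, Prod.fst_neg, Prod.snd_neg, (ρ n).normed_neg, hk.even])
    (δ := r n) (fun s y hs => by simp only [Θ, hρ0 n s hs, zero_mul]) (a := a) (b := b)
    (by linarith) (by linarith) hψs hψp hs (hr0 n).le
  refine h.symm.trans ?_
  congr 1
  refine Finset.sum_congr rfl fun j _ => ?_
  by_cases hj : j = 0
  · subst hj
    simp
  · have hj1 : stDir j = (0, (stDir j).2) := by
      fin_cases j
      · exact absurd rfl hj
      · rfl
      · rfl
    have hΘ' : ∀ w, fderiv ℝ Θ w (stDir j)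
        = (ρ n).normed volume w.1 * fderiv ℝ k w.2 (stDir j).2 := by
      intro w
      have h1 := ((hn.differentiable (by simp) w.1).hasFDerivAt.comp w
        (hasFDerivAt_fst (𝕜 := ℝ) (E := ℝ) (F := V))).mul
        (((hk.smooth.differentiable (by simp)) w.2).hasFDerivAt.comp w
        (hasFDerivAt_snd (𝕜 := ℝ) (E := ℝ) (F := V)))
      have h2 : fderiv ℝ Θ w = _ := h1.fderiv
      rw [h2, hj1]
      simp
    simp only [hΘ']

end TimeMollification

section StripLimits

theorem continuous_integral_mul_translate {G : Type*} [NormedAddCommGroup G] [MeasurableSpace G]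
    [BorelSpace G] [SecondCountableTopology G] [LocallyCompactSpace G] {μ : Measure G}
    [μ.IsAddHaarMeasure] {f g : G → ℝ} (hf : MemLp f 2 μ) (hg : MemLp g 2 μ) :
    Continuous fun c => ∫ z, g z * f (c + z) ∂μ := by
  have : Fact ((2 : ℝ≥0∞) ≠ ⊤) := ⟨by simp⟩
  have hlim : Continuous fun c : G => inner ℝ (DomAddAct.mk c +ᵥ hf.toLp _) (hg.toLp _) :=
    (DomAddAct.continuous_mk.vadd continuous_const).inner continuous_const
  refine hlim.congr fun c => ?_
  rw [L2.inner_def, DomAddAct.mk_vadd_toLp]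
  refine integral_congr_ae ?_
  filter_upwards [hg.coeFn_toLp,
    (hf.comp_measurePreserving (measurePreserving_vadd c μ)).coeFn_toLp] with z h1 h2
  exact congrArg₂ (fun a b => inner ℝ a b) h2 h1

theorem tendsto_setIntegral_mul_translate {f g : ℝ × V → ℝ} (hf : IsStField f) (hg : IsStField g)
    {a b : ℝ} (hs : ∀ t ∉ Set.Icc a b, ∀ x, g (t, x) = 0) :
    Tendsto (fun y : V => ∫ z in strip, g z * f (z - (0, y))) (𝓝 0)
      (𝓝 (∫ z in strip, g z * f z)) := by
  set K : Set (ℝ × V) := Set.Icc a b ×ˢ Set.Icc (-1) 2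
  have hK : IsCompact K := isCompact_Icc.prod isCompact_Icc
  have hloc : LocallyIntegrable fun q => f q ^ 2 :=
    locallyIntegrable_of_strip (fun t => (hf.periodic t).map fun x => x ^ 2)
      (hf.measurable.pow_const 2).stronglyMeasurable hf.integrable_sq
  have hF : MemLp (K.indicator f) 2 := by
    rw [memLp_indicator_iff_restrict hK.measurableSet,
      memLp_two_iff_integrable_sq hf.measurable.aestronglyMeasurable]
    exact hloc.integrableOn_isCompact hK
  have hG : MemLp (strip.indicator g) 2 := by
    rw [memLp_indicator_iff_restrict measurableSet_strip,
      memLp_two_iff_integrable_sq hg.measurable.aestronglyMeasurable]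
    exact hg.integrable_sq
  have hlim := (continuous_integral_mul_translate hF hG).comp
    (by fun_prop : Continuous fun y : V => ((0 : ℝ), -y))
  have key : ∀ y : V, ‖y‖ ≤ 1 → ∫ z, strip.indicator g z * K.indicator f ((0, -y) + z)
      = ∫ z in strip, g z * f (z - (0, y)) := by
    intro y hy
    rw [← integral_indicator measurableSet_strip]
    refine integral_congr_ae (Eventually.of_forall fun z => ?_)
    by_cases hz : z ∈ strip
    · simp only [Set.indicator_of_mem hz]
      by_cases ht : z.1 ∈ Set.Icc a b
      · have hz' : (0, -y) + z ∈ K := by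
          refine ⟨by simpa using ht, ?_⟩
          obtain ⟨⟨h4, h5⟩, h6, h7⟩ := Fund_subset_Icc hz.2
          obtain ⟨h8, h9⟩ := max_le_iff.1 (Prod.norm_def y ▸ hy)
          rw [Real.norm_eq_abs, abs_le] at h8 h9
          simp only [Prod.fst_zero, Prod.snd_zero, Prod.fst_one, Prod.snd_one] at h4 h5 h6 h7
          refine ⟨⟨?_, ?_⟩, ?_, ?_⟩ <;> simp <;> linarith
        rw [Set.indicator_of_mem hz', show (0, -y) + z = z - (0, y) by
          rw [add_comm, sub_eq_add_neg]; simp]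
      · have : g z = 0 := hs _ ht z.2
        simp [this]
    · simp only [Set.indicator_of_notMem hz, zero_mul]
  have h0 := key 0 (by simp)
  have h := hlim.tendsto 0
  simp only [Function.comp_def] at h
  rw [h0] at h
  simp only [show ((0 : ℝ), (0 : V)) = 0 from rfl, sub_zero] at h
  refine h.congr' ?_
  filter_upwards [Metric.closedBall_mem_nhds (0 : V) one_pos] with y hy
  exact key y (by simpa using hy)

theorem tendsto_integral_scaled_mul {φ : V → ℝ} (hφ : IsMollifier φ) {A : V → ℝ} {L : ℝ}
    (hA : Tendsto A (𝓝 0) (𝓝 L)) (hi : ∀ ε > 0, Integrable fun y => scaled φ ε y * A y) :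
    Tendsto (fun ε => ∫ y, scaled φ ε y * A y) (𝓝[>] 0) (𝓝 L) := by
  obtain ⟨C, hC, hz⟩ := hφ.exists_scaled_eq_zero
  rw [Metric.tendsto_nhds]
  intro η hη
  obtain ⟨δ, hδ, hAδ⟩ := Metric.eventually_nhds_iff.1 (Metric.tendsto_nhds.1 hA (η / 2) (by positivity))
  have hev : ∀ᶠ ε : ℝ in 𝓝[>] 0, ε < δ / C :=
    (Iio_mem_nhds (by positivity : (0 : ℝ) < δ / C)) |> mem_nhdsWithin_of_mem_nhds
  filter_upwards [hev, self_mem_nhdsWithin] with ε hε1 hε0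
  have hε : 0 < ε := hε0
  have h1 := hφ.integral_scaled hε
  have hk : Integrable (scaled φ ε) := by
    by_contra h
    rw [integral_undef h] at h1
    exact zero_ne_one h1
  have e : (∫ y, scaled φ ε y * A y) - L = ∫ y, scaled φ ε y * (A y - L) := by
    simp_rw [mul_sub]
    rw [integral_sub (hi ε hε) (hk.mul_const L), integral_mul_const, h1, one_mul]
  rw [dist_eq_norm, e]
  refine lt_of_le_of_lt ?_ (half_lt_self hη)
  calc _ ≤ ∫ y, scaled φ ε y * (η / 2) := by
        refine norm_integral_le_of_norm_le (hk.mul_const _) (Eventually.of_forall fun y => ?_)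
        rw [norm_mul, Real.norm_of_nonneg (hφ.scaled_nonneg y)]
        rcases le_or_gt δ ‖y‖ with hy | hy
        · rw [hz ε hε y ((by rw [lt_div_iff₀ hC] at hε1; linarith : C * ε ≤ δ).trans hy)]
          simp
        · refine mul_le_mul_of_nonneg_left ?_ (hφ.scaled_nonneg y)
          have := hAδ (y := y) (by simpa using hy)
          rw [dist_eq_norm] at this
          exact this.le
    _ = η / 2 := by rw [integral_mul_const, h1, one_mul]

theorem measurable_snd_translate : Measurable fun y : V => ((0 : ℝ), y) := by fun_prop

theorem IsStField.integrable_spaceConv_prod {f g : ℝ × V → ℝ} (hf : IsStField f)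
    (hg : IsStField g) {k : V → ℝ} (hk : Integrable k) :
    Integrable (fun p : (ℝ × V) × V => g p.1 * (k p.2 * f (p.1 - (0, p.2))))
      ((volume.restrict strip).prod volume) :=
  integrable_mul_kernel_prod isAddFundamentalDomain_strip
    (vadd_of_periodic2 hf.periodic) hf.measurable hg.measurable hf.integrable_sq hg.integrable_sq
    measurable_snd_translate hk

theorem IsStField.integrable_mul_spaceConv {f g : ℝ × V → ℝ} (hf : IsStField f)
    (hg : IsStField g) {k : V → ℝ} (hk : Integrable k) :
    IntegrableOn (fun z => g z * spaceConv k f z) strip := by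
  refine (hf.integrable_spaceConv_prod hg hk).integral_prod_left.congr
    (Eventually.of_forall fun z => ?_)
  simp only [integral_const_mul, spaceConv]
  simp [Prod.sub_def]

theorem tendsto_setIntegral_mul_spaceConv {φ : V → ℝ} (hφ : IsMollifier φ) {f g : ℝ × V → ℝ}
    (hf : IsStField f) (hg : IsStField g) (hk : ∀ ε > 0, Integrable (scaled φ ε))
    {a b : ℝ} (hs : ∀ t ∉ Set.Icc a b, ∀ x, g (t, x) = 0) :
    Tendsto (fun ε => ∫ z in strip, g z * spaceConv (scaled φ ε) f z) (𝓝[>] 0)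
      (𝓝 (∫ z in strip, g z * f z)) := by
  have hi := fun ε hε => hf.integrable_spaceConv_prod hg (hk ε hε)
  have e : ∀ (k : V → ℝ) y, ∫ z in strip, g z * (k y * f (z - (0, y)))
      = k y * ∫ z in strip, g z * f (z - (0, y)) := by
    intro k y
    rw [← integral_const_mul]
    exact integral_congr_ae (Eventually.of_forall fun z => by ring)
  refine (tendsto_integral_scaled_mul hφ (tendsto_setIntegral_mul_translate hf hg hs)
    fun ε hε => ?_).congr' ?_
  · simpa only [e] using (hi ε hε).integral_prod_right
  · filter_upwards [self_mem_nhdsWithin] with ε hε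
    have := integral_integral_swap (f := fun z y => g z * (scaled φ ε y * f (z - (0, y)))) (hi ε hε)
    simp only [e] at this
    rw [← this]
    refine integral_congr_ae (Eventually.of_forall fun z => ?_)
    simp only [integral_const_mul, spaceConv]
    simp [Prod.sub_def]

/-- Spatial increments of the velocity weighted by a translated density. -/
theorem tendsto_setIntegral_increment {f : ℝ × V → ℝ} {U H : ℝ × V → V}
    (hfp : ∀ t, Periodic2 fun x => f (t, x)) (hf : Measurable f) (hfi : IntegrableOn f strip)
    (hUm : Measurable U) (hUp : ∀ t, Periodic2 fun x => U (t, x))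
    (hUc : ∀ t, Continuous fun x => U (t, x)) {C : ℝ} (hU : ∀ q, ‖U q‖ ≤ C)
    (hH : Continuous H) (hHp : ∀ t, Periodic2 fun x => H (t, x)) {C' : ℝ} (hHb : ∀ q, ‖H q‖ ≤ C') :
    Tendsto (fun y : V => ∫ z in strip, f (z - (0, y)) * dot (H z) (U z - U (z - (0, y))))
      (𝓝 0) (𝓝 0) := by
  have e : ∀ y : V, ∫ z in strip, f (z - (0, y)) * dot (H z) (U z - U (z - (0, y)))
      = ∫ z in strip, f z * dot (H (z + (0, y))) (U (z + (0, y)) - U z) := by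
    intro y
    refine (setIntegral_translate isAddFundamentalDomain_strip ?_ ((0 : ℝ), y)).symm.trans ?_
    · refine vadd_of_periodic2 (f := fun z => f (z - (0, y)) * dot (H z) (U z - U (z - (0, y))))
        fun t x => ?_
      have e1 : ∀ d : V, ((t, x + d) - ((0 : ℝ), y) : ℝ × V) = (t, x - y + d) := fun d =>
        Prod.ext (sub_zero t) (add_sub_right_comm _ _ _)
      have e2 : ((t, x) - ((0 : ℝ), y) : ℝ × V) = (t, x - y) := Prod.ext (sub_zero t) rfl
      simp only [e1, e2, (hfp _ _).1, (hfp _ _).2, (hHp _ _).1, (hHp _ _).2, (hUp _ _).1,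
        (hUp _ _).2, and_self]
    · simp only [add_sub_cancel_right, strip]
  have hCC : 0 ≤ C := (norm_nonneg _).trans (hU 0)
  have hCC' : 0 ≤ C' := (norm_nonneg _).trans (hHb 0)
  simp only [e]
  suffices Tendsto (fun y : V => ∫ z in strip, f z * dot (H (z + (0, y))) (U (z + (0, y)) - U z))
      (𝓝 0) (𝓝 (∫ z in strip, (0 : ℝ))) by simpa only [integral_zero] using this
  refine tendsto_integral_filter_of_dominated_convergence (fun z => ‖f z‖ * (4 * C * C'))
    (Eventually.of_forall fun y => ?_) (Eventually.of_forall fun y => Eventually.of_forall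
      fun z => ?_) (hfi.norm.mul_const _) (Eventually.of_forall fun z => ?_)
  · have h1 : Measurable fun z : ℝ × V => z + ((0 : ℝ), y) := by fun_prop
    have h2 := hH.measurable.comp h1
    have h3 := (hUm.comp h1).sub hUm
    exact (hf.mul ((h2.fst.mul h3.fst).add (h2.snd.mul h3.snd))).aestronglyMeasurable
  · rw [norm_mul]
    gcongr
    have n1 := hHb (z + (0, y))
    have n2 : ‖U (z + (0, y)) - U z‖ ≤ 2 * C :=
      (norm_sub_le _ _).trans (by linarith [hU (z + (0, y)), hU z])
    calc _ ≤ ‖(H (z + (0, y))).1‖ * ‖(U (z + (0, y)) - U z).1‖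
          + ‖(H (z + (0, y))).2‖ * ‖(U (z + (0, y)) - U z).2‖ := by
            rw [← norm_mul, ← norm_mul]; exact norm_add_le _ _
      _ ≤ C' * (2 * C) + C' * (2 * C) := by
            gcongr
            · exact (norm_fst_le _).trans n1
            · exact (norm_fst_le _).trans n2
            · exact (norm_snd_le _).trans n1
            · exact (norm_snd_le _).trans n2
      _ = _ := by ring
  · have h1 : Continuous fun y : V => H (z + (0, y)) := by fun_prop
    have h2 : Continuous fun y : V => U (z + (0, y)) := by
      have := (hUc z.1).comp (continuous_const.add continuous_id : Continuous fun y : V => z.2 + y)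
      refine this.congr fun y => ?_
      simp only [Function.comp]
      congr 1
      exact Prod.ext (add_zero _).symm rfl
    have h3 := (continuous_const (y := f z)).mul (h1.dot2 (h2.sub (continuous_const (y := U z))))
    have h4 := h3.tendsto (0 : V)
    simpa [dot, show ((0 : ℝ), (0 : V)) = 0 from rfl, Pi.mul_def] using h4

end StripLimits

section Slab

variable {T : ℝ} {k : V → ℝ} {W : ℝ × V → ℝ} {U : ℝ × V → V} {ψ : ℝ × V → ℝ}

theorem integrable_deriv_smul_sub {E : Type*} [NormedAddCommGroup E] [NormedSpace ℝ E]
    (hk : IsKernel k) {f : V → E} (hf : LocallyIntegrable f) (x v : V) :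
    Integrable fun y => fderiv ℝ k y v • f (x - y) :=
  (hk.hasCompactSupport_fderiv_apply v).convolutionExists_left (ContinuousLinearMap.lsmul ℝ ℝ)
    (hk.continuous_fderiv_apply v) hf x

theorem fderiv_conv_sub {E : Type*} [NormedAddCommGroup E] [NormedSpace ℝ E] [CompleteSpace E]
    (hk : IsKernel k) {f : V → E} (hf : LocallyIntegrable f) (x v : V) :
    fderiv ℝ (conv k f) x v = ∫ y, fderiv ℝ k y v • f (x - y) :=
  fderiv_convolution_apply hk.contDiff_one hk.compactSupport hf x v

theorem div2_conv_sub (hk : IsKernel k) {F : V → V} (hF : LocallyIntegrable F) (x : V) :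
    div2 (conv k F) x = (∫ y, fderiv ℝ k y (1, 0) * (F (x - y)).1)
      + ∫ y, fderiv ℝ k y (0, 1) * (F (x - y)).2 := by
  rw [div2, fderiv_conv_sub hk hF, fderiv_conv_sub hk hF,
    fst_integral (integrable_deriv_smul_sub hk hF x _),
    snd_integral (integrable_deriv_smul_sub hk hF x _)]
  rfl

/-- The space-time vorticity flux `(ω, ωu)`. -/
def stFlux (W : ℝ × V → ℝ) (U : ℝ × V → V) : Fin 3 → ℝ × V → ℝ :=
  ![W, fun q => (U q).1 * W q, fun q => (U q).2 * W q]

/-- A weak Euler solution on `(0,T)`, extended by zero to all times. -/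
structure IsSlab (T : ℝ) (W : ℝ × V → ℝ) (U : ℝ × V → V) : Prop where
  slice : ∀ t ∈ Set.Ioo 0 T, IsSlice (fun x => W (t, x)) fun x => U (t, x)
  zero_vorticity : ∀ t ∉ Set.Ioo 0 T, ∀ x, W (t, x) = 0
  zero_velocity : ∀ t ∉ Set.Ioo 0 T, ∀ x, U (t, x) = 0
  measurable_vorticity : Measurable W
  measurable_velocity : Measurable U
  velocity_bound : ∃ C : ℝ, ∀ q, ‖U q‖ ≤ C
  mass_bound : ∃ M : ℝ≥0, ∀ t, ∫⁻ x in Fund, ‖W (t, x)‖ₑ ≤ M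
  energy_bound : ∃ M : ℝ≥0, ∀ t, ∫⁻ x in Fund, ‖W (t, x) ^ 2‖ₑ ≤ M
  weak : WeakEuler T (fun t x => W (t, x)) fun t x => U (t, x)

theorem IsSlab.periodic_vorticity (h : IsSlab T W U) (t : ℝ) : Periodic2 fun x => W (t, x) := by
  by_cases ht : t ∈ Set.Ioo 0 T
  · exact (h.slice t ht).periodic
  · exact fun x => by simp only [h.zero_vorticity t ht, and_self]

theorem IsSlab.periodic_velocity (h : IsSlab T W U) (t : ℝ) : Periodic2 fun x => U (t, x) := by
  by_cases ht : t ∈ Set.Ioo 0 T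
  · exact (h.slice t ht).biotSavart.periodic
  · exact fun x => by simp only [h.zero_velocity t ht, and_self]

theorem IsSlab.continuous_velocity (h : IsSlab T W U) (t : ℝ) : Continuous fun x => U (t, x) := by
  by_cases ht : t ∈ Set.Ioo 0 T
  · exact (h.slice t ht).continuous
  · simp only [h.zero_velocity t ht, continuous_const]

theorem integrableOn_strip_of_bound {f : ℝ × V → ℝ} (hf : Measurable f)
    (hz : ∀ t ∉ Set.Ioo 0 T, ∀ x, f (t, x) = 0)
    (hb : ∃ M : ℝ≥0, ∀ t, ∫⁻ x in Fund, ‖f (t, x)‖ₑ ≤ M) : IntegrableOn f strip := by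
  obtain ⟨M, hM⟩ := hb
  refine ⟨hf.aestronglyMeasurable, ?_⟩
  rw [HasFiniteIntegral, strip_measure, lintegral_prod _ hf.enorm.aemeasurable]
  have hle : ∀ t, ∫⁻ x in Fund, ‖f (t, x)‖ₑ ≤ (Set.Ioo 0 T).indicator (fun _ => (M : ℝ≥0∞)) t := by
    intro t
    by_cases ht : t ∈ Set.Ioo 0 T
    · rw [Set.indicator_of_mem ht]
      exact hM t
    · simp [hz t ht]
  refine (lintegral_mono hle).trans_lt ?_
  rw [lintegral_indicator measurableSet_Ioo, setLIntegral_const]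
  exact ENNReal.mul_lt_top ENNReal.coe_lt_top (by simp)

theorem IsSlab.isStField (h : IsSlab T W U) : IsStField W where
  periodic := h.periodic_vorticity
  measurable := h.measurable_vorticity
  integrable := integrableOn_strip_of_bound h.measurable_vorticity h.zero_vorticity h.mass_bound
  integrable_sq := integrableOn_strip_of_bound (T := T) (h.measurable_vorticity.pow_const 2)
    (fun t ht x => by simp [h.zero_vorticity t ht x]) h.energy_bound

theorem IsSlab.isStField_stFlux (h : IsSlab T W U) (j : Fin 3) : IsStField (stFlux W U j) := by
  obtain ⟨C, hC⟩ := h.velocity_bound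
  fin_cases j
  · exact h.isStField
  · exact h.isStField.bdd_mul h.measurable_velocity.fst
      (fun t => (h.periodic_velocity t).map Prod.fst) fun q => (norm_fst_le _).trans (hC q)
  · exact h.isStField.bdd_mul h.measurable_velocity.snd
      (fun t => (h.periodic_velocity t).map Prod.snd) fun q => (norm_snd_le _).trans (hC q)

theorem IsSlab.mass_bound_stFlux (h : IsSlab T W U) (j : Fin 3) :
    ∃ M : ℝ≥0, ∀ t, ∫⁻ x in Fund, ‖stFlux W U j (t, x)‖ₑ ≤ M := by
  obtain ⟨C, hC⟩ := h.velocity_bound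
  obtain ⟨M, hM⟩ := h.mass_bound
  have key : ∀ b : ℝ × V → ℝ, (∀ q, ‖b q‖ ≤ C) →
      ∃ M : ℝ≥0, ∀ t, ∫⁻ x in Fund, ‖b (t, x) * W (t, x)‖ₑ ≤ M := by
    intro b hb
    refine ⟨C.toNNReal * M, fun t => ?_⟩
    calc _ ≤ ∫⁻ x in Fund, C.toNNReal * ‖W (t, x)‖ₑ := by
          refine lintegral_mono fun x => ?_
          rw [enorm_mul]
          gcongr
          rw [enorm_le_coe, ← NNReal.coe_le_coe, coe_nnnorm]
          exact (hb _).trans (Real.le_coe_toNNReal _)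
      _ ≤ _ := by
          rw [lintegral_const_mul' _ _ ENNReal.coe_ne_top, ENNReal.coe_mul]
          gcongr
          exact hM t
  fin_cases j
  · exact ⟨M, hM⟩
  · exact key _ fun q => (norm_fst_le _).trans (hC q)
  · exact key _ fun q => (norm_snd_le _).trans (hC q)

theorem TestFn.isStField_mul (hψ : TestFn T fun t x => ψ (t, x)) {f : ℝ × V → ℝ}
    (hf : IsStField f) : IsStField fun z => ψ z * f z := by
  obtain ⟨a, b, -, -, hs⟩ := hψ.support
  obtain ⟨C, -, hC⟩ := exists_bound_of_support hψ.contDiff.continuous hψ.periodic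
    fun t ht x => congrFun (hs t ht) x
  exact hf.bdd_mul hψ.contDiff.continuous.measurable hψ.periodic hC

theorem TestFn.continuous_fderiv (hψ : TestFn T fun t x => ψ (t, x)) (v : ℝ × V) :
    Continuous fun z => fderiv ℝ ψ z v :=
  (hψ.contDiff.continuous_fderiv (by simp)).clm_apply continuous_const

theorem TestFn.exists_bound_fderiv (hψ : TestFn T fun t x => ψ (t, x)) (v : ℝ × V) :
    ∃ C, ∀ z, ‖fderiv ℝ ψ z v‖ ≤ C := by
  obtain ⟨a, b, -, -, hs⟩ := hψ.support
  obtain ⟨C, -, hC⟩ := exists_bound_of_support (hψ.continuous_fderiv v)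
    (fderiv_periodic hψ.periodic v)
    (fderiv_eq_zero_of_support (fun t ht x => congrFun (hs t ht) x) v)
  exact ⟨C, hC⟩

theorem TestFn.isStField_fderiv_mul (hψ : TestFn T fun t x => ψ (t, x)) (v : ℝ × V)
    {f : ℝ × V → ℝ} (hf : IsStField f) : IsStField fun z => fderiv ℝ ψ z v * f z := by
  obtain ⟨C, hC⟩ := hψ.exists_bound_fderiv v
  exact hf.bdd_mul (hψ.continuous_fderiv v).measurable (fderiv_periodic hψ.periodic v) hC

theorem fderiv_slice_time (hψ : Differentiable ℝ ψ) (t : ℝ) (x : V) :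
    deriv (fun s => ψ (s, x)) t = fderiv ℝ ψ (t, x) (stDir 0) := by
  have h : HasDerivAt (fun s : ℝ => (s, x)) ((1 : ℝ), (0 : V)) t :=
    (hasDerivAt_id t).prodMk (hasDerivAt_const t x)
  exact ((hψ (t, x)).hasFDerivAt.comp_hasDerivAt t h).deriv

theorem grad2_slice (hψ : Differentiable ℝ ψ) (t : ℝ) (x : V) :
    grad2 (fun y => ψ (t, y)) x = (fderiv ℝ ψ (t, x) (stDir 1), fderiv ℝ ψ (t, x) (stDir 2)) := by
  have h : HasFDerivAt (fun y : V => (t, y)) (ContinuousLinearMap.inr ℝ ℝ V) x :=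
    hasFDerivAt_prodMk_right t x
  have h2 : fderiv ℝ (fun y => ψ (t, y)) x = _ := ((hψ (t, x)).hasFDerivAt.comp x h).fderiv
  rw [grad2, h2]
  rfl

theorem IsSlab.mul_defect_eq (h : IsSlab T W U) (hk : IsKernel k) {t : ℝ}
    (ht : t ∈ Set.Ioo 0 T) (c : ℝ) (x : V) :
    c * defect k (fun y => W (t, y)) (fun y => U (t, y)) x
      = 1 / 2 * ∑ j, (c * stFlux W U 0 (t, x)
            * spaceConv (fun y => fderiv ℝ k y (stDir j).2) (stFlux W U j) (t, x)
          - c * stFlux W U j (t, x)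
            * spaceConv (fun y => fderiv ℝ k y (stDir j).2) (stFlux W U 0) (t, x)) := by
  have hs := h.slice t ht
  rw [defect, div2_conv_sub hk hs.locallyIntegrable_smul, grad2, dot,
    fderiv_conv_sub hk hs.locallyIntegrable, fderiv_conv_sub hk hs.locallyIntegrable,
    Fin.sum_univ_three]
  have d0 : (stDir 0).2 = 0 := rfl
  have d1 : (stDir 1).2 = (1, 0) := rfl
  have d2 : (stDir 2).2 = (0, 1) := rfl
  have f0 : stFlux W U 0 = W := rfl
  have f1 : stFlux W U 1 = fun q => (U q).1 * W q := rfl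
  have f2 : stFlux W U 2 = fun q => (U q).2 * W q := rfl
  simp only [d0, d1, d2, f0, f1, f2, spaceConv, map_zero, zero_mul, integral_zero, mul_zero,
    sub_zero, Prod.smul_fst, Prod.smul_snd, smul_eq_mul, mul_comm (W _) _]
  ring

theorem IsSlab.setIntegral_strip_eq_zero (h : IsSlab T W U) (hψ : TestFn T fun t x => ψ (t, x)) :
    ∫ z in strip, ∑ j, stFlux W U j z * fderiv ℝ ψ z (stDir j) = 0 := by
  have hψd : Differentiable ℝ ψ := hψ.contDiff.differentiable (by simp)
  have hi : IntegrableOn (fun z => ∑ j, stFlux W U j z * fderiv ℝ ψ z (stDir j)) strip :=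
    integrable_finsetSum _ fun j _ => by
      simpa only [mul_comm, IntegrableOn] using
        (hψ.isStField_fderiv_mul (stDir j) (h.isStField_stFlux j)).integrable
  rw [IntegrableOn, strip_measure] at hi
  rw [strip_measure, integral_prod _ hi,
    ← setIntegral_eq_integral_of_forall_compl_eq_zero (s := Set.Ioo 0 T)]
  · refine Eq.trans ?_ (h.weak _ hψ)
    refine setIntegral_congr_fun measurableSet_Ioo fun t _ => ?_
    refine integral_congr_ae (Eventually.of_forall fun x => ?_)
    simp only [fderiv_slice_time hψd, grad2_slice hψd, Fin.sum_univ_three, stFlux, dot]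
    simp
    ring
  · intro t ht
    simp [Fin.sum_univ_three, stFlux, h.zero_vorticity t ht]

theorem IsSlab.integral_defect (h : IsSlab T W U) (hk : IsKernel k)
    (hψ : TestFn T fun t x => ψ (t, x)) :
    IntegrableOn (fun t => ∫ x in Fund,
        ψ (t, x) * defect k (fun y => W (t, y)) (fun y => U (t, y)) x) (Set.Ioo 0 T) ∧
      ∫ t in Set.Ioo 0 T, ∫ x in Fund,
        ψ (t, x) * defect k (fun y => W (t, y)) (fun y => U (t, y)) x
      = 1 / 2 * ∑ j, ∫ z in strip, (fderiv ℝ ψ z (stDir j) * stFlux W U j z)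
          * spaceConv k (stFlux W U 0) z := by
  have hd : ∀ v : V, Integrable fun y => fderiv ℝ k y v := fun v =>
    (hk.continuous_fderiv_apply v).integrable_of_hasCompactSupport
      (hk.hasCompactSupport_fderiv_apply v)
  let R : ℝ × V → ℝ := fun z => 1 / 2 * ∑ j, (ψ z * stFlux W U 0 z
            * spaceConv (fun y => fderiv ℝ k y (stDir j).2) (stFlux W U j) z
          - ψ z * stFlux W U j z
            * spaceConv (fun y => fderiv ℝ k y (stDir j).2) (stFlux W U 0) z)
  have i1 := fun j => (h.isStField_stFlux j).integrable_mul_spaceConv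
    (hψ.isStField_mul (h.isStField_stFlux 0)) (hd (stDir j).2)
  have i2 := fun j => (h.isStField_stFlux 0).integrable_mul_spaceConv
    (hψ.isStField_mul (h.isStField_stFlux j)) (hd (stDir j).2)
  have hRi : IntegrableOn R strip :=
    (integrable_finsetSum _ fun j _ => (i1 j).fun_sub (i2 j)).const_mul _
  have hRp : Integrable R ((volume : Measure ℝ).prod (volume.restrict Fund)) := by
    rw [← strip_measure]; exact hRi
  have e : ∀ t ∈ Set.Ioo 0 T, (∫ x in Fund,
      ψ (t, x) * defect k (fun y => W (t, y)) (fun y => U (t, y)) x) = ∫ x in Fund, R (t, x) :=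
    fun t ht => integral_congr_ae (Eventually.of_forall fun x => h.mul_defect_eq hk ht _ x)
  have hR0 : ∀ t ∉ Set.Ioo 0 T, ∫ x in Fund, R (t, x) = 0 := by
    intro t ht
    refine integral_eq_zero_of_ae (Eventually.of_forall fun x => ?_)
    have : ∀ j, stFlux W U j (t, x) = 0 := by
      intro j
      fin_cases j <;> simp [stFlux, h.zero_vorticity t ht]
    simp [R, this]
  refine ⟨(hRp.integral_prod_left.integrableOn).congr_fun (fun t ht => (e t ht).symm)
    measurableSet_Ioo, ?_⟩
  rw [setIntegral_congr_fun measurableSet_Ioo e,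
    setIntegral_eq_integral_of_forall_compl_eq_zero hR0, ← integral_prod _ hRp, ← strip_measure]
  have hw := weak_commutator_space h.isStField_stFlux h.mass_bound_stFlux (fun _ => h.setIntegral_strip_eq_zero) hk hψ
  simp only [R]
  rw [integral_const_mul, integral_finsetSum _ fun j _ => (i1 j).fun_sub (i2 j),
    Finset.sum_congr rfl fun j _ => integral_sub (i1 j) (i2 j)]
  rw [Finset.sum_sub_distrib] at hw ⊢
  linarith

theorem IsSlice.dot_spaceFlux {w : V → ℝ} {u : V → V} (h : IsSlice w u) (hk : IsKernel k)
    (v x : V) : dot v (spaceFlux k w u x)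
      = ∫ y, k y * w (x - y) ^ 2 * dot v (u x - u (x - y)) := by
  have hc := hk.contDiff_one.continuous
  have i1 : Integrable fun y => k y * w (x - y) ^ 2 :=
    hk.compactSupport.convolutionExists_left (ContinuousLinearMap.lsmul ℝ ℝ) hc
      h.locallyIntegrable_sq x
  have i2 : Integrable fun y => k y • (w (x - y) ^ 2 • u (x - y)) :=
    hk.compactSupport.convolutionExists_left (ContinuousLinearMap.lsmul ℝ ℝ) hc
      h.locallyIntegrable_sq_smul x
  have e : spaceFlux k w u x = ∫ y, ((k y * w (x - y) ^ 2) • u x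
      - k y • (w (x - y) ^ 2 • u (x - y))) := by
    rw [integral_sub (i1.smul_const _) i2, integral_smul_const]
    rfl
  have i3 : Integrable fun y =>
      (k y * w (x - y) ^ 2) • u x - k y • (w (x - y) ^ 2 • u (x - y)) :=
    Integrable.sub (i1.smul_const (u x)) i2
  rw [e, dot, fst_integral i3, snd_integral i3, ← integral_const_mul, ← integral_const_mul,
    ← integral_add (i3.fst.const_mul _) (i3.snd.const_mul _)]
  refine integral_congr_ae (Eventually.of_forall fun y => ?_)
  simp only [dot, Prod.fst_sub, Prod.snd_sub, Prod.smul_fst, Prod.smul_snd,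
    smul_eq_mul]
  ring

theorem IsSlab.integral_dot_spaceFlux (h : IsSlab T W U) (hk : IsKernel k)
    (hψ : TestFn T fun t x => ψ (t, x)) :
    IntegrableOn (fun t => ∫ x in Fund, dot (grad2 (fun y => ψ (t, y)) x)
        (spaceFlux k (fun y => W (t, y)) (fun y => U (t, y)) x)) (Set.Ioo 0 T) ∧
      (Integrable fun y : V => k y * ∫ z in strip, W (z - (0, y)) ^ 2
        * dot (fderiv ℝ ψ z (stDir 1), fderiv ℝ ψ z (stDir 2)) (U z - U (z - (0, y)))) ∧
      ∫ t in Set.Ioo 0 T, ∫ x in Fund, dot (grad2 (fun y => ψ (t, y)) x)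
        (spaceFlux k (fun y => W (t, y)) (fun y => U (t, y)) x)
      = ∫ y : V, k y * ∫ z in strip, W (z - (0, y)) ^ 2
        * dot (fderiv ℝ ψ z (stDir 1), fderiv ℝ ψ z (stDir 2)) (U z - U (z - (0, y))) := by
  obtain ⟨C, hC⟩ := h.velocity_bound
  obtain ⟨C₁, hC₁⟩ := hψ.exists_bound_fderiv (stDir 1)
  obtain ⟨C₂, hC₂⟩ := hψ.exists_bound_fderiv (stDir 2)
  let P : (ℝ × V) × V → ℝ := fun p =>
    dot (fderiv ℝ ψ p.1 (stDir 1), fderiv ℝ ψ p.1 (stDir 2)) (U p.1 - U (p.1 - (0, p.2)))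
      * (k p.2 * W (p.1 - (0, p.2)) ^ 2)
  have hP : Integrable P ((volume.restrict strip).prod volume) := by
    have hki : Integrable k :=
      hk.contDiff_one.continuous.integrable_of_hasCompactSupport hk.compactSupport
    have h1 := integrable_kernel_prod isAddFundamentalDomain_strip
      (vadd_of_periodic2 fun t => (h.periodic_vorticity t).map fun a => a ^ 2)
      (h.measurable_vorticity.pow_const 2) h.isStField.integrable_sq measurable_snd_translate hki
    have m1 := (hψ.continuous_fderiv (stDir 1)).measurable.comp
      (measurable_fst : Measurable (Prod.fst : (ℝ × V) × V → ℝ × V))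
    have m2 := (hψ.continuous_fderiv (stDir 2)).measurable.comp
      (measurable_fst : Measurable (Prod.fst : (ℝ × V) × V → ℝ × V))
    have m3 := (h.measurable_velocity.comp
      (measurable_fst : Measurable (Prod.fst : (ℝ × V) × V → ℝ × V))).sub
      (h.measurable_velocity.comp (measurable_fst.sub (measurable_snd_translate.comp measurable_snd)
        : Measurable fun p : (ℝ × V) × V => p.1 - ((0 : ℝ), p.2)))
    refine h1.bdd_mul (c := C₁ * (2 * C) + C₂ * (2 * C))
      ((m1.mul m3.fst).add (m2.mul m3.snd)).aestronglyMeasurable (Eventually.of_forall fun p => ?_)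
    have n : ‖U p.1 - U (p.1 - (0, p.2))‖ ≤ 2 * C :=
      (norm_sub_le _ _).trans (by linarith [hC p.1, hC (p.1 - (0, p.2))])
    refine (norm_add_le _ _).trans ?_
    rw [norm_mul, norm_mul]
    have c1 : 0 ≤ C₁ := (norm_nonneg _).trans (hC₁ 0)
    have c2 : 0 ≤ C₂ := (norm_nonneg _).trans (hC₂ 0)
    gcongr
    · exact hC₁ _
    · exact (norm_fst_le _).trans n
    · exact hC₂ _
    · exact (norm_snd_le _).trans n
  have e1 : ∀ y, ∫ z in strip, P (z, y) = k y * ∫ z in strip, W (z - (0, y)) ^ 2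
      * dot (fderiv ℝ ψ z (stDir 1), fderiv ℝ ψ z (stDir 2)) (U z - U (z - (0, y))) := by
    intro y
    rw [← integral_const_mul]
    exact integral_congr_ae (Eventually.of_forall fun z => by simp only [P]; ring)
  let R : ℝ × V → ℝ := fun z => ∫ y, P (z, y)
  have hR : Integrable R ((volume : Measure ℝ).prod (volume.restrict Fund)) := by
    rw [← strip_measure]; exact hP.integral_prod_left
  have hR0 : ∀ t ∉ Set.Ioo 0 T, ∫ x in Fund, R (t, x) = 0 := by
    intro t ht
    refine integral_eq_zero_of_ae (Eventually.of_forall fun x => integral_eq_zero_of_ae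
      (Eventually.of_forall fun y => ?_))
    simp [P, h.zero_vorticity t ht]
  have e2 : ∀ t ∈ Set.Ioo 0 T, (∫ x in Fund, dot (grad2 (fun y => ψ (t, y)) x)
      (spaceFlux k (fun y => W (t, y)) (fun y => U (t, y)) x)) = ∫ x in Fund, R (t, x) := by
    intro t ht
    refine integral_congr_ae (Eventually.of_forall fun x => ?_)
    simp only [(h.slice t ht).dot_spaceFlux hk, R, P, Prod.mk_sub_mk, sub_zero,
      grad2_slice (hψ.contDiff.differentiable (by simp))]
    exact integral_congr_ae (Eventually.of_forall fun y => mul_comm _ _)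
  refine ⟨hR.integral_prod_left.integrableOn.congr_fun (fun t ht => (e2 t ht).symm)
    measurableSet_Ioo, by simpa only [e1] using hP.integral_prod_right, ?_⟩
  rw [setIntegral_congr_fun measurableSet_Ioo e2,
    setIntegral_eq_integral_of_forall_compl_eq_zero hR0, ← integral_prod _ hR, ← strip_measure]
  simp only [← e1]
  exact integral_integral_swap (f := fun z y => P (z, y)) hP

theorem IsSlab.tendsto_flux (h : IsSlab T W U) {φ : V → ℝ} (hφ : IsMollifier φ)
    (heven : ∀ x, φ (-x) = φ x) (hψ : TestFn T fun t x => ψ (t, x)) :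
    Tendsto (fun ε : ℝ => ∫ t in Set.Ioo 0 T, ∫ x in Fund, ψ (t, x) * ((1 / 4) *
        ∫ l, dot (grad2 (scaled φ ε) l) (U (t, x + l) - U (t, x))
          * (W (t, x + l) - W (t, x)) ^ 2))
      (𝓝[>] 0)
      (𝓝 (∫ t in Set.Ioo 0 T, ∫ x in Fund,
        (deriv (fun s => ψ (s, x)) t * ((1 / 2) * W (t, x) ^ 2)
          + dot (grad2 (fun y => ψ (t, y)) x) (U (t, x)) * ((1 / 2) * W (t, x) ^ 2)))) := by
  have hk := fun ε (hε : 0 < ε) => hφ.isKernel_scaled heven hε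
  have hψd : Differentiable ℝ ψ := hψ.contDiff.differentiable (by simp)
  obtain ⟨a, b, -, -, hs⟩ := hψ.support
  replace hs : ∀ t ∉ Set.Icc a b, ∀ x, ψ (t, x) = 0 := fun t ht x => congrFun (hs t ht) x
  have hfj := fun j => hψ.isStField_fderiv_mul (stDir j) (h.isStField_stFlux j)
  have lim1 := fun j => tendsto_setIntegral_mul_spaceConv hφ h.isStField (hfj j)
    (fun ε hε => (hk ε hε).contDiff_one.continuous.integrable_of_hasCompactSupport
      (hk ε hε).compactSupport) (a := a) (b := b)
    (fun t ht x => by rw [fderiv_eq_zero_of_support hs _ t ht, zero_mul])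
  obtain ⟨C, hC⟩ := h.velocity_bound
  obtain ⟨C₁, hC₁⟩ := hψ.exists_bound_fderiv (stDir 1)
  obtain ⟨C₂, hC₂⟩ := hψ.exists_bound_fderiv (stDir 2)
  have lim2 := tendsto_integral_scaled_mul hφ (tendsto_setIntegral_increment
    (fun t => (h.periodic_vorticity t).map fun a => a ^ 2) (h.measurable_vorticity.pow_const 2)
    h.isStField.integrable_sq h.measurable_velocity h.periodic_velocity h.continuous_velocity hC
    (H := fun z => (fderiv ℝ ψ z (stDir 1), fderiv ℝ ψ z (stDir 2)))
    ((hψ.continuous_fderiv _).prodMk (hψ.continuous_fderiv _))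
    (fun t => (fderiv_periodic hψ.periodic _ t).map₂ (fderiv_periodic hψ.periodic _ t) Prod.mk)
    (C' := max C₁ C₂) (fun q => max_le_max (hC₁ q) (hC₂ q)))
    fun ε hε => (h.integral_dot_spaceFlux (hk ε hε) hψ).2.1
  have lim := (lim2.const_mul (-(1 / 4))).add
    ((tendsto_finsetSum Finset.univ fun j _ => lim1 j).const_mul (1 / 2))
  have target : ∫ t in Set.Ioo 0 T, ∫ x in Fund,
        (deriv (fun s => ψ (s, x)) t * ((1 / 2) * W (t, x) ^ 2)
          + dot (grad2 (fun y => ψ (t, y)) x) (U (t, x)) * ((1 / 2) * W (t, x) ^ 2))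
      = -(1 / 4) * 0 + 1 / 2 * ∑ j, ∫ z in strip, (fderiv ℝ ψ z (stDir j) * stFlux W U j z) * W z := by
    have hij : ∀ j, IntegrableOn (fun z => (fderiv ℝ ψ z (stDir j) * stFlux W U j z) * W z) strip :=
      fun j => MemLp.integrable_mul
        ((memLp_two_iff_integrable_sq (hfj j).measurable.aestronglyMeasurable).2
          (hfj j).integrable_sq)
        ((memLp_two_iff_integrable_sq h.isStField.measurable.aestronglyMeasurable).2
          h.isStField.integrable_sq)
    let R : ℝ × V → ℝ := fun z => 1 / 2 * ∑ j, (fderiv ℝ ψ z (stDir j) * stFlux W U j z) * W z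
    have hR : Integrable R ((volume : Measure ℝ).prod (volume.restrict Fund)) := by
      rw [← strip_measure]
      exact (integrable_finsetSum _ fun j _ => hij j).const_mul _
    have e : ∀ t x, deriv (fun s => ψ (s, x)) t * ((1 / 2) * W (t, x) ^ 2)
          + dot (grad2 (fun y => ψ (t, y)) x) (U (t, x)) * ((1 / 2) * W (t, x) ^ 2)
        = R (t, x) := by
      intro t x
      have f0 : stFlux W U 0 = W := rfl
      have f1 : stFlux W U 1 = fun q => (U q).1 * W q := rfl
      have f2 : stFlux W U 2 = fun q => (U q).2 * W q := rfl
      simp only [R, fderiv_slice_time hψd, grad2_slice hψd, dot, Fin.sum_univ_three, f0, f1, f2]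
      ring
    have hR0 : ∀ t ∉ Set.Ioo 0 T, ∫ x in Fund, R (t, x) = 0 := by
      intro t ht
      refine integral_eq_zero_of_ae (Eventually.of_forall fun x => ?_)
      simp [R, h.zero_vorticity t ht]
    simp only [e]
    rw [setIntegral_eq_integral_of_forall_compl_eq_zero hR0, ← integral_prod _ hR, ← strip_measure,
      integral_const_mul, integral_finsetSum _ fun j _ => hij j]
    ring
  rw [target]
  refine lim.congr' ?_
  filter_upwards [self_mem_nhdsWithin] with ε hε
  obtain ⟨i1, -, e1⟩ := h.integral_dot_spaceFlux (hk ε hε) hψ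
  obtain ⟨i2, e2⟩ := h.integral_defect (hk ε hε) hψ
  have e3 : ∀ t ∈ Set.Ioo 0 T, (∫ x in Fund, ψ (t, x) * ((1 / 4) *
        ∫ l, dot (grad2 (scaled φ ε) l) (U (t, x + l) - U (t, x))
          * (W (t, x + l) - W (t, x)) ^ 2))
      = -(1 / 4) * (∫ x in Fund, dot (grad2 (fun y => ψ (t, y)) x)
          (spaceFlux (scaled φ ε) (fun y => W (t, y)) (fun y => U (t, y)) x))
        + ∫ x in Fund, ψ (t, x) * defect (scaled φ ε) (fun y => W (t, y)) (fun y => U (t, y)) x := by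
    intro t ht
    have hχ : ContDiff ℝ 1 fun x => ψ (t, x) :=
      (hψ.contDiff.comp (contDiff_prodMk_right t)).of_le (by exact_mod_cast le_top)
    have := (h.slice t ht).integral_flux (hk ε hε) hχ (hψ.periodic t)
    simp only [mul_left_comm _ (1 / 4 : ℝ)]
    rw [integral_const_mul, this]
    ring
  rw [setIntegral_congr_fun measurableSet_Ioo e3, integral_add (i1.const_mul _) i2,
    integral_const_mul, e1, e2]
  rfl

end Slab

section WeakSolution

variable {T p : ℝ} {ω : ℝ → V → ℝ} {u : ℝ → V → V}

theorem isSlice_of_eLpNorm_ne_top {w : V → ℝ} {v : V → V} (hp : 2 < p) (hm : Measurable w)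
    (hper : Periodic2 w) (hBS : BiotSavart w v) (hb : eLpNorm w (ENNReal.ofReal p) μT ≠ ⊤) :
    IsSlice w v := by
  have h2 : MemLp w 2 μT := MemLp.mono_exponent ⟨hm.aestronglyMeasurable, hb.lt_top⟩
    (by rw [← ENNReal.ofReal_ofNat]; exact ENNReal.ofReal_le_ofReal hp.le)
  exact ⟨hper, hm, h2.integrable one_le_two, h2.integrable_sq, hBS⟩

theorem lintegral_enorm_le_of_eLpNorm_le {w : V → ℝ} (hp : 2 < p) (hm : Measurable w)
    {M : ℝ≥0} (hb : eLpNorm w (ENNReal.ofReal p) μT ≤ M) : ∫⁻ x in Fund, ‖w x‖ₑ ≤ M := by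
  refine le_trans ?_ hb
  rw [← eLpNorm_one_eq_lintegral_enorm]
  refine eLpNorm_le_eLpNorm_of_exponent_le (μ := μT) ?_ hm.aestronglyMeasurable
  rw [← ENNReal.ofReal_one]
  exact ENNReal.ofReal_le_ofReal (by linarith)

theorem lintegral_enorm_sq_le_of_eLpNorm_le {w : V → ℝ} (hp : 2 < p) (hm : Measurable w)
    {M : ℝ≥0} (hb : eLpNorm w (ENNReal.ofReal p) μT ≤ M) :
    ∫⁻ x in Fund, ‖w x ^ 2‖ₑ ≤ (M ^ 2 : ℝ≥0) := by
  have h2 : eLpNorm w 2 μT ≤ M := by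
    refine le_trans ?_ hb
    refine eLpNorm_le_eLpNorm_of_exponent_le (μ := μT) ?_ hm.aestronglyMeasurable
    rw [← ENNReal.ofReal_ofNat]
    exact ENNReal.ofReal_le_ofReal hp.le
  calc ∫⁻ x in Fund, ‖w x ^ 2‖ₑ = ∫⁻ x, ‖w x‖ₑ ^ (2 : ℝ) ∂μT := by
        refine lintegral_congr fun x => ?_
        rw [enorm_pow, ENNReal.rpow_two]
    _ = eLpNorm w 2 μT ^ (2 : ℝ) := by
        rw [eLpNorm_eq_lintegral_rpow_enorm_toReal two_ne_zero ENNReal.ofNat_ne_top]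
        simp only [ENNReal.toReal_ofNat]
        rw [← ENNReal.rpow_mul]
        norm_num
    _ ≤ (M ^ 2 : ℝ≥0) := by
        rw [ENNReal.rpow_two, ENNReal.coe_pow]
        gcongr

/-- Extension by zero of a time-dependent function to times outside `(0,T)`. -/
def extendTime {E : Type*} [Zero E] (T : ℝ) (f : ℝ → V → E) (q : ℝ × V) : E :=
  (Set.Ioo 0 T).indicator (fun t => f t q.2) q.1

theorem extendTime_of_mem {E : Type*} [Zero E] {f : ℝ → V → E} {t : ℝ} (ht : t ∈ Set.Ioo 0 T)
    (x : V) : extendTime T f (t, x) = f t x :=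
  Set.indicator_of_mem ht _

theorem extendTime_of_notMem {E : Type*} [Zero E] {f : ℝ → V → E} {t : ℝ} (ht : t ∉ Set.Ioo 0 T)
    (x : V) : extendTime T f (t, x) = 0 :=
  Set.indicator_of_notMem ht _

theorem isSlab_extendTime (hp : 2 < p) (hmeas : Measurable (Function.uncurry ω))
    (hslice : ∀ t ∈ Set.Ioo 0 T, IsSlice (ω t) (u t)) {M : ℝ≥0}
    (hM : ∀ t ∈ Set.Ioo 0 T, eLpNorm (ω t) (ENNReal.ofReal p) μT ≤ M) (hweak : WeakEuler T ω u) :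
    IsSlab T (extendTime T ω) (extendTime T u) where
  slice t ht := by simpa only [extendTime_of_mem ht] using hslice t ht
  zero_vorticity t ht := extendTime_of_notMem ht
  zero_velocity t ht := extendTime_of_notMem ht
  measurable_vorticity := hmeas.indicator (measurable_fst measurableSet_Ioo)
  measurable_velocity := measurable_velocity measurableSet_Ioo hmeas hslice
  velocity_bound := by
    obtain ⟨C, hC0, hC⟩ := exists_velocity_bound hp
    refine ⟨C * M, fun ⟨t, x⟩ => ?_⟩
    by_cases ht : t ∈ Set.Ioo 0 T
    · rw [extendTime_of_mem ht]
      refine (hC _ _ (hslice t ht) (ne_top_of_le_ne_top ENNReal.coe_ne_top (hM t ht)) x).trans ?_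
      gcongr
      exact ENNReal.toReal_le_coe_of_le_coe (hM t ht)
    · rw [extendTime_of_notMem ht, norm_zero]
      positivity
  mass_bound := by
    refine ⟨M, fun t => ?_⟩
    by_cases ht : t ∈ Set.Ioo 0 T
    · simpa only [extendTime_of_mem ht] using
        lintegral_enorm_le_of_eLpNorm_le hp (hslice t ht).measurable (hM t ht)
    · simp [extendTime_of_notMem ht]
  energy_bound := by
    refine ⟨M ^ 2, fun t => ?_⟩
    by_cases ht : t ∈ Set.Ioo 0 T
    · simpa only [extendTime_of_mem ht] using
        lintegral_enorm_sq_le_of_eLpNorm_le hp (hslice t ht).measurable (hM t ht)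
    · simp [extendTime_of_notMem ht]
  weak ψ hψ := by
    refine Eq.trans ?_ (hweak ψ hψ)
    refine setIntegral_congr_fun measurableSet_Ioo fun t ht => ?_
    simp only [extendTime_of_mem ht]

end WeakSolution

/-- local "−2 law": for a weak Euler solution `ω ∈ L^∞(0,T;L^p)`, `p > 2`,
`u = K∗ω`, and an even mollifier `φ`, the identity
`∫d²ℓ ∇φ_ε(ℓ)·Δ_ℓu |Δ_ℓω|² = ∇·[u(ω²)_ε − (uω²)_ε] + 4Z̃_ε(ω)` holds (distributionally in
space, for a.e. time), where `Z̃_ε(ω) = ½ω∇·[(ωu)_ε] − ½ω(u·∇)ω_ε`; consequently the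
enstrophy defect has the representation
`Z(ω) = lim_{ε→0} ¼∫d²ℓ ∇φ_ε(ℓ)·Δ_ℓu |Δ_ℓω|²` in the sense of distributions. -/
theorem stmt12 (T p : ℝ) (hT : 0 < T) (hp : 2 < p)
    (φ : V → ℝ) (hφ : IsMollifier φ) (heven : ∀ x : V, φ (-x) = φ x)
    (ω : ℝ → V → ℝ) (u : ℝ → V → V)
    (hmeas : Measurable (Function.uncurry ω))
    (hper : ∀ t ∈ Set.Ioo 0 T, Periodic2 (ω t))
    (hBS : ∀ t ∈ Set.Ioo 0 T, BiotSavart (ω t) (u t))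
    (hbound : ∃ M : ℝ≥0, ∀ t ∈ Set.Ioo 0 T, eLpNorm (ω t) (ENNReal.ofReal p) μT ≤ M)
    (hweak : WeakEuler T ω u) :
    (∀ ε : ℝ, 0 < ε → ∀ᵐ t ∂volume.restrict (Set.Ioo 0 T), ∀ χ : V → ℝ, SpTest χ →
      ∫ x in Fund, χ x *
          (∫ ℓ, dot (grad2 (scaled φ ε) ℓ) (u t (x + ℓ) - u t x)
            * (ω t (x + ℓ) - ω t x) ^ 2)
        = -(∫ x in Fund, dot (grad2 χ x)
              (mollify φ ε (fun z => (ω t z) ^ 2) x • u t x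
                - mollify φ ε (fun z => (ω t z) ^ 2 • u t z) x))
          + 4 * ∫ x in Fund, χ x *
              ((1/2) * ω t x * div2 (mollify φ ε (fun y => ω t y • u t y)) x
                - (1/2) * ω t x * dot (u t x) (grad2 (mollify φ ε (ω t)) x)))
    ∧ (∀ ψ : ℝ → V → ℝ, TestFn T ψ →
        Filter.Tendsto (fun ε : ℝ =>
            ∫ t in Set.Ioo 0 T, ∫ x in Fund,
              ψ t x * ((1/4) *
                ∫ ℓ, dot (grad2 (scaled φ ε) ℓ) (u t (x + ℓ) - u t x)
                  * (ω t (x + ℓ) - ω t x) ^ 2))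
          (nhdsWithin 0 (Set.Ioi 0))
          (nhds (∫ t in Set.Ioo 0 T, ∫ x in Fund,
              ((deriv (fun s => ψ s x) t) * ((1/2) * (ω t x) ^ 2)
                + dot (grad2 (ψ t) x) (u t x) * ((1/2) * (ω t x) ^ 2))))) := by
  obtain ⟨M, hM⟩ := hbound
  have hslice : ∀ t ∈ Set.Ioo 0 T, IsSlice (ω t) (u t) := fun t ht =>
    isSlice_of_eLpNorm_ne_top hp hmeas.of_uncurry_left (hper t ht) (hBS t ht)
      (ne_top_of_le_ne_top ENNReal.coe_ne_top (hM t ht))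
  refine ⟨fun ε hε => ae_restrict_of_forall_mem measurableSet_Ioo fun t ht χ hχ =>
    (hslice t ht).integral_flux (hφ.isKernel_scaled heven hε) (hχ.smooth.of_le (by simp))
      hχ.periodic, fun ψ hψ => ?_⟩
  have lim := (isSlab_extendTime hp hmeas hslice hM hweak).tendsto_flux hφ heven
    (ψ := Function.uncurry ψ) hψ
  convert lim using 2
  · refine setIntegral_congr_fun measurableSet_Ioo fun t ht => ?_
    simp only [extendTime_of_mem ht, Function.uncurry_apply_pair]
  · refine setIntegral_congr_fun measurableSet_Ioo fun t ht => ?_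
    simp only [extendTime_of_mem ht, Function.uncurry_apply_pair]

end
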